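/- arXiv:2112.00205 — 2 statements merged into one kernel-verified Lean document; each statement's English description precedes it below -/
import Mathlib

section
/- A non-empty bicategory B is filtered if and only if B satisfies the three axioms (0-Flt), (1-Flt) and (2-Flt). -/
open CategoryTheory Bicategory

universe w v u w' v' u'

namespace Paper

/-- A pseudo-cocone of a pseudofunctor `F : C ⥤ B` with apex `E : B`: it consists of 1-cells
`app A : F A ⟶ E` and invertible 2-cells `nat f : F f ≫ app A' ≅ app A`, satisfying the unity,
composition and 2-cell-naturality axioms of a pseudonatural transformation into the constant
pseudofunctor on `E`. -/
structure PseudoCocone {C : Type u'} [Bicategory.{w', v'} C] {B : Type u} [Bicategory.{w, v} B]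
    (F : Pseudofunctor C B) (E : B) where
  app (A : C) : F.obj A ⟶ E
  nat {A A' : C} (f : A ⟶ A') : F.map f ≫ app A' ≅ app A
  unity (A : C) :
    (nat (𝟙 A)).hom = ((F.mapId A).hom ▷ app A) ≫ (λ_ (app A)).hom
  comp {A A' A'' : C} (f : A ⟶ A') (g : A' ⟶ A'') :
    (nat (f ≫ g)).hom =
      ((F.mapComp f g).hom ▷ app A'') ≫ (α_ (F.map f) (F.map g) (app A'')).hom ≫
        (F.map f ◁ (nat g).hom) ≫ (nat f).hom
  nat2 {A A' : C} {f g : A ⟶ A'} (γ : f ⟶ g) :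
    (F.map₂ γ ▷ app A') ≫ (nat g).hom = (nat f).hom

/-- A bicategory is finite if it has finitely many objects, 1-cells and 2-cells. -/
def FiniteBicategory (C : Type u') [Bicategory.{w', v'} C] : Prop :=
  Finite C ∧ (∀ a b : C, Finite (a ⟶ b)) ∧ ∀ (a b : C) (f g : a ⟶ b), Finite (f ⟶ g)

/-- A (non-empty) bicategory is filtered if every pseudofunctor from a finite bicategory
admits a pseudo-cocone. -/
def IsFiltered (B : Type u) [Bicategory.{w, v} B] : Prop :=
  ∀ (C : Type u') [Bicategory.{w', v'} C], FiniteBicategory C →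
    ∀ F : Pseudofunctor C B, ∃ E : B, Nonempty (PseudoCocone F E)

/-- Axiom (0-Flt). -/
def Flt0 (B : Type u) [Bicategory.{w, v} B] : Prop :=
  ∀ A B' : B, ∃ (C : B) (_ : A ⟶ C) (_ : B' ⟶ C), True

/-- Axiom (1-Flt). -/
def Flt1 (B : Type u) [Bicategory.{w, v} B] : Prop :=
  ∀ ⦃A B' : B⦄ (f g : A ⟶ B'), ∃ (C : B) (u : B' ⟶ C) (_ : f ≫ u ⟶ g ≫ u), True

/-- Axiom (2-Flt). -/
def Flt2 (B : Type u) [Bicategory.{w, v} B] : Prop :=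
  ∀ ⦃A B' : B⦄ (f g : A ⟶ B') (α β : f ⟶ g), ∃ (C : B) (u : B' ⟶ C), α ▷ u = β ▷ u

section Backward

variable {B : Type u} [Bicategory.{w, v} B]

lemma exists_target [Nonempty B] (h0 : Flt0 B) {ι : Type*} [Finite ι] (X : ι → B) :
    ∃ E : B, ∀ i, Nonempty (X i ⟶ E) := by
  classical
  have := Fintype.ofFinite ι
  suffices h : ∀ s : Finset ι, ∃ E : B, ∀ i ∈ s, Nonempty (X i ⟶ E) by
    obtain ⟨E, hE⟩ := h Finset.univ
    exact ⟨E, fun i => hE i (Finset.mem_univ i)⟩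
  intro s
  induction s using Finset.induction_on with
  | empty => exact ⟨Classical.arbitrary B, by simp⟩
  | insert a s _ ih =>
    obtain ⟨E, hE⟩ := ih
    obtain ⟨E', p, q, -⟩ := h0 E (X a)
    refine ⟨E', fun i hi => ?_⟩
    rcases Finset.mem_insert.1 hi with rfl | hi
    · exact ⟨q⟩
    · exact ⟨(hE i hi).some ≫ p⟩

lemma exists_all {ι : Type*} [Finite ι] {E : B} (P : ι → ∀ E' : B, (E ⟶ E') → Prop)
    (mono : ∀ i (E' E'' : B) (p : E ⟶ E') (q : E' ⟶ E''), P i E' p → P i E'' (p ≫ q))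
    (ex : ∀ i (E' : B) (p : E ⟶ E'), ∃ (E'' : B) (q : E' ⟶ E''), P i E'' (p ≫ q)) :
    ∃ (E' : B) (p : E ⟶ E'), ∀ i, P i E' p := by
  classical
  have := Fintype.ofFinite ι
  suffices h : ∀ s : Finset ι, ∃ (E' : B) (p : E ⟶ E'), ∀ i ∈ s, P i E' p by
    obtain ⟨E', p, hE⟩ := h Finset.univ
    exact ⟨E', p, fun i => hE i (Finset.mem_univ i)⟩
  intro s
  induction s using Finset.induction_on with
  | empty => exact ⟨E, 𝟙 E, by simp⟩
  | insert a s _ ih =>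
    obtain ⟨E', p, hE⟩ := ih
    obtain ⟨E'', q, hq⟩ := ex a E' p
    refine ⟨E'', p ≫ q, fun i hi => ?_⟩
    rcases Finset.mem_insert.1 hi with rfl | hi
    · exact hq
    · exact mono _ _ _ _ _ (hE i hi)

lemma whisker_eq_mono {X Y Z W : B} {f g : X ⟶ Y} {a b : f ⟶ g} {p : Y ⟶ Z} (q : Z ⟶ W)
    (h : a ▷ p = b ▷ p) : a ▷ (p ≫ q) = b ▷ (p ≫ q) := by
  simp [h]

lemma exists_iso (h1 : Flt1 B) (h2 : Flt2 B) {X Y : B} (f g : X ⟶ Y) :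
    ∃ (Z : B) (p : Y ⟶ Z), Nonempty (f ≫ p ≅ g ≫ p) := by
  obtain ⟨Z, p, a, -⟩ := h1 f g
  obtain ⟨Z', q, b, -⟩ := h1 (g ≫ p) (f ≫ p)
  obtain ⟨Z1, r, hr⟩ := h2 _ _ (a ▷ q ≫ b) (𝟙 _)
  obtain ⟨Z2, s, hs⟩ := h2 _ _ ((b ≫ a ▷ q) ▷ r) (𝟙 _)
  refine ⟨Z2, p ≫ q ≫ r ≫ s, ⟨?_⟩⟩
  have e : ((f ≫ p) ≫ q) ≫ (r ≫ s) ≅ ((g ≫ p) ≫ q) ≫ (r ≫ s) :=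
    { hom := (a ▷ q) ▷ (r ≫ s)
      inv := b ▷ (r ≫ s)
      hom_inv_id := by
        rw [← comp_whiskerRight, whisker_eq_mono s hr, id_whiskerRight]
      inv_hom_id := by
        rw [← comp_whiskerRight, whiskerRight_comp, hs]
        simp }
  exact (α_ _ _ _).symm ≪≫ (α_ _ _ _).symm ≪≫ e ≪≫ α_ _ _ _ ≪≫ α_ _ _ _

/-- A pair of parallel 2-cells. -/
structure Par (E : B) where
  X : B
  f : X ⟶ E
  g : X ⟶ E
  a : f ⟶ g
  b : f ⟶ g

lemma exists_equalize (h2 : Flt2 B) {ι : Type*} [Finite ι] {E : B} (P : ι → Par E) :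
    ∃ (E' : B) (p : E ⟶ E'), ∀ i, (P i).a ▷ p = (P i).b ▷ p := by
  refine exists_all (fun i E' p => (P i).a ▷ p = (P i).b ▷ p) ?_ ?_
  · intro i E' E'' p q h
    exact whisker_eq_mono q h
  · intro i E' p
    obtain ⟨Z, q, h⟩ := h2 _ _ ((P i).a ▷ p) ((P i).b ▷ p)
    exact ⟨Z, q, by simp [h]⟩

lemma exists_isos (h1 : Flt1 B) (h2 : Flt2 B) {ι : Type*} [Finite ι] {E : B} (X : ι → B)
    (f g : ∀ i, X i ⟶ E) :
    ∃ (E' : B) (p : E ⟶ E'), ∀ i, Nonempty (f i ≫ p ≅ g i ≫ p) := by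
  refine exists_all (fun i E' p => Nonempty (f i ≫ p ≅ g i ≫ p)) ?_ ?_
  · rintro i E' E'' p q ⟨h⟩
    exact ⟨(α_ _ _ _).symm ≪≫ whiskerRightIso h q ≪≫ α_ _ _ _⟩
  · intro i E' p
    obtain ⟨Z, q, ⟨h⟩⟩ := exists_iso h1 h2 (f i ≫ p) (g i ≫ p)
    exact ⟨Z, q, ⟨(α_ _ _ _).symm ≪≫ h ≪≫ α_ _ _ _⟩⟩

theorem filtered_of_axioms [Nonempty B] (h0 : Flt0 B) (h1 : Flt1 B) (h2 : Flt2 B) :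
    IsFiltered.{w, v, u, w', v', u'} B := by
  intro C _ hC F
  obtain ⟨hC0, hC1, hC2⟩ := hC
  obtain ⟨E₀, h⟩ := exists_target h0 F.obj
  let t : ∀ A, F.obj A ⟶ E₀ := fun A => (h A).some
  obtain ⟨E₁, p, hp⟩ := exists_isos h1 h2 (ι := Σ A A' : C, A ⟶ A') (fun i => F.obj i.1)
    (fun i => F.map i.2.2 ≫ t i.2.1) (fun i => t i.1)
  let app : ∀ A, F.obj A ⟶ E₁ := fun A => t A ≫ p
  let nat : ∀ {A A' : C} (f : A ⟶ A'), F.map f ≫ app A' ≅ app A := fun {A A'} f =>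
    (α_ _ _ _).symm ≪≫ (hp ⟨A, A', f⟩).some
  let P1 : C → Par E₁ := fun A => ⟨_, _, _, (nat (𝟙 A)).hom,
    ((F.mapId A).hom ▷ app A) ≫ (λ_ (app A)).hom⟩
  let P2 : (Σ A A' A'' : C, (A ⟶ A') × (A' ⟶ A'')) → Par E₁ := fun i =>
    ⟨_, _, _, (nat (i.2.2.2.1 ≫ i.2.2.2.2)).hom,
      ((F.mapComp i.2.2.2.1 i.2.2.2.2).hom ▷ app i.2.2.1) ≫
        (α_ (F.map i.2.2.2.1) (F.map i.2.2.2.2) (app i.2.2.1)).hom ≫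
        (F.map i.2.2.2.1 ◁ (nat i.2.2.2.2).hom) ≫ (nat i.2.2.2.1).hom⟩
  let P3 : (Σ (A A' : C) (f g : A ⟶ A'), f ⟶ g) → Par E₁ := fun i =>
    ⟨_, _, _, (F.map₂ i.2.2.2.2 ▷ app i.2.1) ≫ (nat i.2.2.2.1).hom, (nat i.2.2.1).hom⟩
  obtain ⟨E, q, hq⟩ := exists_equalize h2 (Sum.elim P1 (Sum.elim P2 P3))
  have hq1 : ∀ A : C, (nat (𝟙 A)).hom ▷ q =
      (((F.mapId A).hom ▷ app A) ≫ (λ_ (app A)).hom) ▷ q := fun A => hq (Sum.inl A)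
  have hq2 : ∀ {A A' A'' : C} (f : A ⟶ A') (g : A' ⟶ A''), (nat (f ≫ g)).hom ▷ q =
      (((F.mapComp f g).hom ▷ app A'') ≫ (α_ (F.map f) (F.map g) (app A'')).hom ≫
        (F.map f ◁ (nat g).hom) ≫ (nat f).hom) ▷ q :=
    fun {A A' A''} f g => hq (Sum.inr (Sum.inl ⟨A, A', A'', f, g⟩))
  have hq3 : ∀ {A A' : C} {f g : A ⟶ A'} (γ : f ⟶ g),
      ((F.map₂ γ ▷ app A') ≫ (nat g).hom) ▷ q = (nat f).hom ▷ q :=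
    fun {A A' f g} γ => hq (Sum.inr (Sum.inr ⟨A, A', f, g, γ⟩))
  clear_value app nat
  refine ⟨E, ⟨?_⟩⟩
  exact
    { app := fun A => app A ≫ q
      nat := fun {A A'} f => (α_ _ _ _).symm ≪≫ whiskerRightIso (nat f) q
      unity := fun A => by
        simp [hq1]
      comp := fun {A A' A''} f g => by
        simp [hq2]
      nat2 := fun {A A' f g} γ => by
        simp [← hq3 γ] }

end Backward

section Forward

/-- The objects of the two-object bicategory with a prescribed hom-category. -/
inductive Two : Type u'
  | zero
  | one

/-- 1-cells of the suspension of `K`. -/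
def SuspHom (K : Type v') : Two.{u'} → Two.{u'} → Type v'
  | .zero, .zero => PUnit
  | .zero, .one => K
  | .one, .zero => PEmpty
  | .one, .one => PUnit

/-- 2-cells of the suspension of `K`. -/
def SuspHom₂ (K : Type v') [Category.{w'} K] :
    ∀ a b : Two.{u'}, SuspHom K a b → SuspHom K a b → Type w'
  | .zero, .zero, _, _ => PUnit
  | .zero, .one, f, g => Quiver.Hom (V := K) f g
  | .one, .zero, _, _ => PUnit
  | .one, .one, _, _ => PUnit

/-- The hom-categories of the suspension of `K`. -/
instance suspHomCat (K : Type v') [Category.{w'} K] :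
    ∀ a b : Two.{u'}, Category.{w'} (SuspHom K a b)
  | .zero, .zero =>
    { Hom := SuspHom₂ K .zero .zero, id := fun _ => PUnit.unit, comp := fun _ _ => PUnit.unit }
  | .zero, .one =>
    { Hom := SuspHom₂ K .zero .one
      id := fun f => CategoryStruct.id (obj := K) f
      comp := fun a b => CategoryStruct.comp (obj := K) a b
      id_comp := fun a => Category.id_comp (obj := K) a
      comp_id := fun a => Category.comp_id (obj := K) a
      assoc := fun a b c => Category.assoc (obj := K) a b c }
  | .one, .zero =>
    { Hom := SuspHom₂ K .one .zero, id := fun _ => PUnit.unit, comp := fun _ _ => PUnit.unit }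
  | .one, .one =>
    { Hom := SuspHom₂ K .one .one, id := fun _ => PUnit.unit, comp := fun _ _ => PUnit.unit }

/-- Identity 1-cells. -/
def suspId (K : Type v') : ∀ a : Two.{u'}, SuspHom K a a
  | .zero => PUnit.unit
  | .one => PUnit.unit

/-- Composition of 1-cells. -/
def suspComp (K : Type v') : ∀ a b c : Two.{u'}, SuspHom K a b → SuspHom K b c → SuspHom K a c
  | .zero, .zero, _, _, g => g
  | .zero, .one, .one, f, _ => f
  | .zero, .one, .zero, _, g => PEmpty.elim g
  | .one, .zero, _, f, _ => PEmpty.elim f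
  | .one, .one, _, _, g => g

/-- Left whiskering. -/
def suspWL (K : Type v') [Category.{w'} K] : ∀ (a b c : Two.{u'}) (f : SuspHom K a b)
    {g h : SuspHom K b c}, (g ⟶ h) → (suspComp K a b c f g ⟶ suspComp K a b c f h)
  | .zero, .zero, _, _, _, _, t => t
  | .zero, .one, .one, f, _, _, _ => 𝟙 f
  | .zero, .one, .zero, _, g, _, _ => PEmpty.elim g
  | .one, .zero, _, f, _, _, _ => PEmpty.elim f
  | .one, .one, _, _, _, _, t => t

/-- Right whiskering. -/
def suspWR (K : Type v') [Category.{w'} K] : ∀ (a b c : Two.{u'}) {f g : SuspHom K a b}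
    (_ : f ⟶ g) (h : SuspHom K b c), (suspComp K a b c f h ⟶ suspComp K a b c g h)
  | .zero, .zero, _, _, _, _, h => 𝟙 h
  | .zero, .one, .one, _, _, t, _ => t
  | .zero, .one, .zero, _, _, _, h => PEmpty.elim h
  | .one, .zero, _, f, _, _, _ => PEmpty.elim f
  | .one, .one, _, _, _, _, h => 𝟙 h

theorem suspComp_assoc (K : Type v') : ∀ (a b c d : Two.{u'}) (f : SuspHom K a b)
    (g : SuspHom K b c) (h : SuspHom K c d),
    suspComp K a c d (suspComp K a b c f g) h = suspComp K a b d f (suspComp K b c d g h) := by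
  rintro (_ | _) (_ | _) (_ | _) (_ | _) f g h <;>
    first | rfl | exact PEmpty.elim f | exact PEmpty.elim g | exact PEmpty.elim h

theorem suspId_comp (K : Type v') : ∀ (a b : Two.{u'}) (f : SuspHom K a b),
    suspComp K a a b (suspId K a) f = f := by
  rintro (_ | _) (_ | _) f <;> rfl

theorem suspComp_id (K : Type v') : ∀ (a b : Two.{u'}) (f : SuspHom K a b),
    suspComp K a b b f (suspId K b) = f := by
  rintro (_ | _) (_ | _) f <;> first | rfl | exact PEmpty.elim f

/-- The bicategory with two objects `0`, `1` and hom-category `K` from `0` to `1`. -/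
structure Susp (K : Type v') : Type u' where
  of : Two.{u'}

instance (K : Type v') [Category.{w'} K] : Bicategory.{w', v'} (Susp.{v', u'} K) where
  Hom a b := SuspHom K a.of b.of
  id a := suspId K a.of
  comp {a b c} f g := suspComp K a.of b.of c.of f g
  homCategory a b := suspHomCat K a.of b.of
  whiskerLeft {a b c} f _ _ t := suspWL K a.of b.of c.of f t
  whiskerRight {a b c} _ _ t h := suspWR K a.of b.of c.of t h
  associator {a b c d} f g h := eqToIso (suspComp_assoc K a.of b.of c.of d.of f g h)
  leftUnitor {a b} f := eqToIso (suspId_comp K a.of b.of f)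
  rightUnitor {a b} f := eqToIso (suspComp_id K a.of b.of f)
  whiskerLeft_id := by
    rintro ⟨_ | _⟩ ⟨_ | _⟩ ⟨_ | _⟩ f g <;>
    first | rfl | exact PEmpty.elim f | exact PEmpty.elim g
  whiskerLeft_comp := by
    rintro ⟨_ | _⟩ ⟨_ | _⟩ ⟨_ | _⟩ f g h i s t <;>
    first | rfl | exact PEmpty.elim f | exact PEmpty.elim g | exact (Category.comp_id _).symm
  id_whiskerLeft := by
    rintro ⟨_ | _⟩ ⟨_ | _⟩ f g t <;>
    first | rfl | exact PEmpty.elim f | (erw [Category.id_comp, Category.comp_id]; rfl)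
  comp_whiskerLeft := by
    rintro ⟨_ | _⟩ ⟨_ | _⟩ ⟨_ | _⟩ ⟨_ | _⟩ f g h h' t <;>
    first | rfl | exact PEmpty.elim f | exact PEmpty.elim g | exact PEmpty.elim h
          | (erw [Category.id_comp, Category.comp_id]; rfl)
  id_whiskerRight := by
    rintro ⟨_ | _⟩ ⟨_ | _⟩ ⟨_ | _⟩ f g <;>
    first | rfl | exact PEmpty.elim f | exact PEmpty.elim g
  comp_whiskerRight := by
    rintro ⟨_ | _⟩ ⟨_ | _⟩ ⟨_ | _⟩ f g h s t i <;>
    first | rfl | exact PEmpty.elim f | exact PEmpty.elim i | exact (Category.comp_id _).symm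
  whiskerRight_id := by
    rintro ⟨_ | _⟩ ⟨_ | _⟩ f g t <;>
    first | rfl | exact PEmpty.elim f | (erw [Category.id_comp, Category.comp_id]; rfl)
  whiskerRight_comp := by
    rintro ⟨_ | _⟩ ⟨_ | _⟩ ⟨_ | _⟩ ⟨_ | _⟩ f f' t g h <;>
    first | rfl | exact PEmpty.elim f | exact PEmpty.elim g | exact PEmpty.elim h
          | (erw [Category.id_comp, Category.comp_id]; rfl)
  whisker_assoc := by
    rintro ⟨_ | _⟩ ⟨_ | _⟩ ⟨_ | _⟩ ⟨_ | _⟩ f g g' t h <;>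
    first | rfl | exact PEmpty.elim f | exact PEmpty.elim g | exact PEmpty.elim h
          | (erw [Category.id_comp, Category.comp_id]; rfl)
  whisker_exchange := by
    rintro ⟨_ | _⟩ ⟨_ | _⟩ ⟨_ | _⟩ f g h i s t <;>
    first | rfl | exact PEmpty.elim f | exact PEmpty.elim h
          | (erw [Category.id_comp, Category.comp_id]; rfl)
  pentagon := by
    rintro ⟨_ | _⟩ ⟨_ | _⟩ ⟨_ | _⟩ ⟨_ | _⟩ ⟨_ | _⟩ f g h i <;>
    first | rfl | exact PEmpty.elim f | exact PEmpty.elim g | exact PEmpty.elim h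
          | exact PEmpty.elim i
          | (erw [Category.id_comp, Category.comp_id])
  triangle := by
    rintro ⟨_ | _⟩ ⟨_ | _⟩ ⟨_ | _⟩ f g <;>
    first | rfl | exact PEmpty.elim f | exact PEmpty.elim g
          | (erw [Category.id_comp]; rfl)

variable {B : Type u} [Bicategory.{w, v} B]

/-- Objects of the pseudofunctor attached to `G`. -/
def suspObj (X Y : B) : Two.{u'} → B
  | .zero => X
  | .one => Y

/-- 1-cells of the pseudofunctor attached to `G`. -/
def suspMap {K : Type v'} [Category.{w'} K] {X Y : B} (G : K ⥤ (X ⟶ Y)) :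
    ∀ a b : Two.{u'}, SuspHom K a b → (suspObj X Y a ⟶ suspObj X Y b)
  | .zero, .zero, _ => 𝟙 X
  | .zero, .one, k => G.obj k
  | .one, .zero, k => PEmpty.elim k
  | .one, .one, _ => 𝟙 Y

/-- 2-cells of the pseudofunctor attached to `G`. -/
def suspMap₂ {K : Type v'} [Category.{w'} K] {X Y : B} (G : K ⥤ (X ⟶ Y)) :
    ∀ (a b : Two.{u'}) {f g : SuspHom K a b}, (f ⟶ g) → (suspMap G a b f ⟶ suspMap G a b g)
  | .zero, .zero, _, _, _ => 𝟙 (𝟙 X)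
  | .zero, .one, _, _, t => G.map t
  | .one, .zero, k, _, _ => PEmpty.elim k
  | .one, .one, _, _, _ => 𝟙 (𝟙 Y)

/-- Unit constraint. -/
def suspMapId {K : Type v'} [Category.{w'} K] {X Y : B} (G : K ⥤ (X ⟶ Y)) :
    ∀ a : Two.{u'}, suspMap G a a (suspId K a) ≅ 𝟙 (suspObj X Y a)
  | .zero => Iso.refl (𝟙 X)
  | .one => Iso.refl (𝟙 Y)

/-- Composition constraint. -/
def suspMapComp {K : Type v'} [Category.{w'} K] {X Y : B} (G : K ⥤ (X ⟶ Y)) :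
    ∀ (a b c : Two.{u'}) (f : SuspHom K a b) (g : SuspHom K b c),
      suspMap G a c (suspComp K a b c f g) ≅ suspMap G a b f ≫ suspMap G b c g
  | .zero, .zero, c, _, g => (λ_ (suspMap G .zero c g)).symm
  | .zero, .one, .one, f, _ => (ρ_ (suspMap G .zero .one f)).symm
  | .zero, .one, .zero, _, g => PEmpty.elim g
  | .one, .zero, _, f, _ => PEmpty.elim f
  | .one, .one, c, _, g => (λ_ (suspMap G .one c g)).symm

lemma coh_wl {X Y : B} {f g : X ⟶ Y} (t : f ⟶ g) :
    t = (λ_ f).inv ≫ 𝟙 X ◁ t ≫ (λ_ g).hom := by simp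

lemma coh_wr {X Y : B} {f g : X ⟶ Y} (t : f ⟶ g) :
    t = (ρ_ f).inv ≫ t ▷ 𝟙 Y ≫ (ρ_ g).hom := by simp

lemma coh_wl' {X Y : B} (f : X ⟶ Y) :
    𝟙 f = (ρ_ f).inv ≫ f ◁ 𝟙 (𝟙 Y) ≫ (ρ_ f).hom := by simp

lemma coh_wr' {X Y : B} (f : X ⟶ Y) :
    𝟙 f = (λ_ f).inv ≫ 𝟙 (𝟙 X) ▷ f ≫ (λ_ f).hom := by simp

lemma coh_a1 {X Y : B} (h : X ⟶ Y) :
    𝟙 h = (λ_ h).inv ≫ (λ_ (𝟙 X)).inv ▷ h ≫ (α_ (𝟙 X) (𝟙 X) h).hom ≫ 𝟙 X ◁ (λ_ h).hom ≫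
      (λ_ h).hom := by simp

lemma coh_a2 {X Y : B} (h : X ⟶ Y) :
    𝟙 h = (ρ_ h).inv ≫ (λ_ h).inv ▷ 𝟙 Y ≫ (α_ (𝟙 X) h (𝟙 Y)).hom ≫ 𝟙 X ◁ (ρ_ h).hom ≫
      (λ_ h).hom := by simp

lemma coh_a3 {X Y : B} (h : X ⟶ Y) :
    𝟙 h = (ρ_ h).inv ≫ (ρ_ h).inv ▷ 𝟙 Y ≫ (α_ h (𝟙 Y) (𝟙 Y)).hom ≫ h ◁ (λ_ (𝟙 Y)).hom ≫
      (ρ_ h).hom := by simp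

lemma coh_r {X : B} :
    𝟙 (𝟙 X) = (λ_ (𝟙 X)).inv ≫ 𝟙 X ◁ 𝟙 (𝟙 X) ≫ (ρ_ (𝟙 X)).hom := by
  simp

/-- The pseudofunctor out of the suspension attached to `G`. -/
def suspFunctor {K : Type v'} [Category.{w'} K] {X Y : B} (G : K ⥤ (X ⟶ Y)) :
    Pseudofunctor (Susp.{v', u'} K) B where
  obj a := suspObj X Y a.of
  map {a b} f := suspMap G a.of b.of f
  map₂ {a b} _ _ t := suspMap₂ G a.of b.of t
  mapId a := suspMapId G a.of
  mapComp {a b c} f g := suspMapComp G a.of b.of c.of f g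
  map₂_id := by
    rintro ⟨_ | _⟩ ⟨_ | _⟩ f <;>
    first | rfl | exact PEmpty.elim f | exact G.map_id _
  map₂_comp := by
    rintro ⟨_ | _⟩ ⟨_ | _⟩ f g h s t <;>
    first | exact PEmpty.elim f | exact G.map_comp _ _ | exact (Category.comp_id _).symm
  map₂_whisker_left := by
    rintro ⟨_ | _⟩ ⟨_ | _⟩ ⟨_ | _⟩ f g h t <;>
    first | exact PEmpty.elim f | exact PEmpty.elim g | skip
    all_goals first | exact coh_wl _ | exact coh_wl (G.map _) | exact coh_wl' _ | exact (G.map_id _).trans (coh_wl' _)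
  map₂_whisker_right := by
    rintro ⟨_ | _⟩ ⟨_ | _⟩ ⟨_ | _⟩ f g t h <;>
    first | exact PEmpty.elim f | exact PEmpty.elim h | skip
    all_goals first | exact coh_wr' _ | exact (G.map_id _).trans (coh_wr' _) | exact coh_wr _ | exact coh_wr (G.map _)
  map₂_associator := by
    rintro ⟨_ | _⟩ ⟨_ | _⟩ ⟨_ | _⟩ ⟨_ | _⟩ f g h <;>
    first | exact PEmpty.elim f | exact PEmpty.elim g | exact PEmpty.elim h | skip
    all_goals first | exact coh_a1 _ | exact (G.map_id _).trans (coh_a1 _) | exact coh_a2 _ | exact (G.map_id _).trans (coh_a2 _) | exact coh_a3 _ | exact (G.map_id _).trans (coh_a3 _)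
  map₂_left_unitor := by
    rintro ⟨_ | _⟩ ⟨_ | _⟩ f <;>
    first | exact PEmpty.elim f | skip
    all_goals first | exact coh_wr' _ | exact (G.map_id _).trans (coh_wr' _)
  map₂_right_unitor := by
    rintro ⟨_ | _⟩ ⟨_ | _⟩ f <;>
    first | exact PEmpty.elim f | skip
    all_goals first | exact coh_wl' _ | exact (G.map_id _).trans (coh_wl' _) | exact coh_r

theorem finite_susp (K : Type v') [Category.{w'} K] [Finite K] [∀ a b : K, Finite (a ⟶ b)] :
    FiniteBicategory (Susp.{v', u'} K) := by
  refine ⟨?_, ?_, ?_⟩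
  · refine Finite.of_surjective (fun b : Bool => (⟨if b then .zero else .one⟩ : Susp.{v', u'} K)) ?_
    rintro ⟨_ | _⟩
    · exact ⟨true, rfl⟩
    · exact ⟨false, rfl⟩
  · rintro ⟨_ | _⟩ ⟨_ | _⟩
    · exact inferInstanceAs (Finite PUnit)
    · exact inferInstanceAs (Finite K)
    · exact inferInstanceAs (Finite PEmpty)
    · exact inferInstanceAs (Finite PUnit)
  · rintro ⟨_ | _⟩ ⟨_ | _⟩ f g
    · exact inferInstanceAs (Finite PUnit)
    · exact (inferInstance : ∀ a b : K, Finite (a ⟶ b)) f g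
    · exact inferInstanceAs (Finite PUnit)
    · exact inferInstanceAs (Finite PUnit)

/-- What filteredness gives for a small finite diagram in a hom-category. -/
theorem cocone_susp (hB : IsFiltered.{w, v, u, w', v', u'} B) (K : Type) [Category.{0} K]
    [Finite K] [∀ a b : K, Finite (a ⟶ b)] {X Y : B} (G : K ⥤ (X ⟶ Y)) :
    ∃ (E : B) (x : X ⟶ E) (y : Y ⟶ E) (n : ∀ k, G.obj k ≫ y ≅ x),
      ∀ {k l : K} (t : k ⟶ l), G.map t ▷ y ≫ (n l).hom = (n k).hom := by
  letI : Category.{0} (ULift.{v'} K) := uliftCategory K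
  let K' := ULiftHom.{w'} (ULift.{v'} K)
  let d : K' ⥤ K := ULiftHom.down ⋙ ULift.downFunctor
  let up : K ⥤ K' := ULift.upFunctor ⋙ ULiftHom.up
  have : Finite K' := inferInstanceAs (Finite (ULift K))
  have : ∀ a b : K', Finite (a ⟶ b) := fun a b =>
    inferInstanceAs (Finite (ULift (d.obj a ⟶ d.obj b)))
  obtain ⟨E, ⟨θ⟩⟩ := hB (Susp.{v', u'} K') (finite_susp K') (suspFunctor (d ⋙ G))
  refine ⟨E, θ.app ⟨.zero⟩, θ.app ⟨.one⟩, fun k =>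
    θ.nat (A := ⟨.zero⟩) (A' := ⟨.one⟩) (up.obj k), fun {k l} t => ?_⟩
  exact θ.nat2 (A := ⟨.zero⟩) (A' := ⟨.one⟩) (f := up.obj k) (g := up.obj l) (up.map t)

theorem axioms_of_filtered (hB : IsFiltered.{w, v, u, w', v', u'} B) :
    Flt0 B ∧ Flt1 B ∧ Flt2 B := by
  refine ⟨?_, ?_, ?_⟩
  · intro X Y
    obtain ⟨E, x, y, -⟩ := cocone_susp hB (Discrete Empty) (X := X) (Y := Y)
      (Discrete.functor (fun e => Empty.elim e))
    exact ⟨E, x, y, trivial⟩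
  · intro X Y f g
    obtain ⟨E, x, y, n, -⟩ := cocone_susp hB (Discrete Bool)
      (Discrete.functor (fun b => if b then f else g))
    exact ⟨E, y, (n ⟨true⟩).hom ≫ (n ⟨false⟩).inv, trivial⟩
  · intro X Y f g a b
    obtain ⟨E, x, y, n, h⟩ := cocone_susp hB Limits.WalkingParallelPair (Limits.parallelPair a b)
    refine ⟨E, y, ?_⟩
    have h1 := h Limits.WalkingParallelPairHom.left
    have h2 := h Limits.WalkingParallelPairHom.right
    exact (cancel_mono (n Limits.WalkingParallelPair.one).hom).1 (h1.trans h2.symm)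

end Forward

/-- A non-empty bicategory `B` is filtered if and only if it satisfies the three axioms
(0-Flt), (1-Flt) and (2-Flt). -/
theorem filtered_iff_axioms (B : Type u) [Bicategory.{w, v} B] [Nonempty B] :
    IsFiltered.{w, v, u, w', v', u'} B ↔ Flt0 B ∧ Flt1 B ∧ Flt2 B := by
  exact ⟨axioms_of_filtered, fun h => filtered_of_axioms h.1 h.2.1 h.2.2⟩

end Paper
end

section
/- Let B be a bicategory, W a class of 1-cells of B admitting a right bicalculus of fractions, and A, B₀ objects of B. Let F : (W/A)^op → Cat be the pseudofunctor sending (C, w) to the hom-category B(C, B₀), a 1-cell (f, α) to the precomposition functor (− ∘ f), and 2-cells to the corresponding whiskerings. Then the category Colim_{(W/A)^op} F (the pseudofiltered pseudo-colimit construction applied to F) is isomorphic to the following category B[W⁻¹](A, B₀): objects are triples (C, w, f) with w : C → A in W and f : C → B₀; morphisms (C₁, w₁, f₁) → (C₂, w₂, f₂) are equivalence classes of quintuples (C, u, v, α, ξ), where u : C → C₁ and v : C → C₂ are 1-cells, α : w₁ ∘ u ≅ w₂ ∘ v is an invertible 2-cell, ξ : f₁ ∘ u ⟹ f₂ ∘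 v is a 2-cell, and w₁ ∘ u is isomorphic via an invertible 2-cell to an arrow of W; two quintuples (C, u, v, α, ξ) and (C̃, ũ, ṽ, α̃, ξ̃) are equivalent if there exist an object C̄, 1-cells h : C̄ → C and h̃ : C̄ → C̃, and invertible 2-cells γ : u ∘ h ≅ ũ ∘ h̃ and δ : v ∘ h ≅ ṽ ∘ h̃ such that w₁ ∘ (u ∘ h) is isomorphic to an arrow of W, the pasting of α̃ with γ equals the pasting of α with δ, and the pasting of ξ̃ with γ equals the pasting of ξ with δ (equations (eq:eqbetweenfractions1) and (eq:eqbetweenfractions2) of the paper); identities are classes of (C, 1_C, 1_C, identity data); and composition of [(C, u, v, α, ξ)] followed by [(C', u', v', α', ξ')] is defined by choosing, via the fractions axioms, an object D, 1-cells h : D → C, g : D → C' and an invertible 2-cell γ : v ∘ h ≅ u' ∘ g, and pasting α, γ, α' for the invertible component and ξ, γ, ξ' for the 2-cell component, as in Pronk's construction of the hom-categories of the bicategory of fractions. -/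
open CategoryTheory Bicategory

universe w v u

namespace Paper

variable {B : Type u} [Bicategory.{w, v} B]

/-- A 1-cell is an equivalence if there is a 1-cell in the opposite direction and invertible
2-cells relating the two composites to identities. -/
def IsEquiv1Cell {a b : B} (f : a ⟶ b) : Prop :=
  ∃ g : b ⟶ a, Nonempty (f ≫ g ≅ 𝟙 a) ∧ Nonempty (g ≫ f ≅ 𝟙 b)

/-- Axiom (0-Frc). -/
def Frc0 (W : ∀ ⦃a b : B⦄, (a ⟶ b) → Prop) : Prop :=
  ∀ ⦃A B' C : B⦄ (w : A ⟶ B') (f : C ⟶ B'), W w →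
    ∃ (D : B) (u : D ⟶ C) (h : D ⟶ A), W u ∧ Nonempty (u ≫ f ≅ h ≫ w)

/-- Axiom (1-Frc). -/
def Frc1 (W : ∀ ⦃a b : B⦄, (a ⟶ b) → Prop) : Prop :=
  ∀ ⦃B' C D : B⦄ (w : C ⟶ D) (f g : B' ⟶ C), W w → ∀ α : f ≫ w ⟶ g ≫ w,
    ∃ (A : B) (u : A ⟶ B'), W u ∧ ∃ β : u ≫ f ⟶ u ≫ g,
      (u ◁ α) ≫ (α_ u g w).inv = (α_ u f w).inv ≫ (β ▷ w)

/-- Axiom (2-Frc). -/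
def Frc2 (W : ∀ ⦃a b : B⦄, (a ⟶ b) → Prop) : Prop :=
  ∀ ⦃B' C D : B⦄ (w : C ⟶ D) (f g : B' ⟶ C), W w → ∀ α β : f ⟶ g,
    α ▷ w = β ▷ w → ∃ (A : B) (u : A ⟶ B'), W u ∧ u ◁ α = u ◁ β

/-- A class of 1-cells admits a right bicalculus of fractions. -/
structure RightBicalculus (W : ∀ ⦃a b : B⦄, (a ⟶ b) → Prop) : Prop where
  equivalences : ∀ ⦃a b : B⦄ (f : a ⟶ b), IsEquiv1Cell f → W f
  comp : ∀ ⦃a b c : B⦄ (f : a ⟶ b) (g : b ⟶ c), W f → W g → W (f ≫ g)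
  iso_closed : ∀ ⦃a b : B⦄ (f w : a ⟶ b), W w → Nonempty (f ≅ w) → W f
  frc0 : Frc0 W
  frc1 : Frc1 W
  frc2 : Frc2 W

/-- `x` is isomorphic, via an invertible 2-cell, to an arrow of `W`. -/
def IsoToW (W : ∀ ⦃a b : B⦄, (a ⟶ b) → Prop) {a b : B} (x : a ⟶ b) : Prop :=
  ∃ w' : a ⟶ b, W w' ∧ Nonempty (x ≅ w')

variable (W : ∀ ⦃a b : B⦄, (a ⟶ b) → Prop) (A B₀ : B)

/-- An object of both categories: a triple `(C, w, f)` with `w : C ⟶ A` in `W` and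
`f : C ⟶ B₀`. This is simultaneously an object of `Colim_{(W/A)ᵒᵖ} F_A^{B₀}` (a pair of an
object `(C, w)` of `W/A` and an object `f` of `F_A^{B₀}(C, w) = B(C, B₀)`), and an arrow
`A → B₀` of Pronk's bicategory of fractions. -/
structure FracObj where
  C : B
  w : C ⟶ A
  mem : W w
  f : C ⟶ B₀

variable {W A B₀}

/-- A premorphism of `Colim_{(W/A)ᵒᵖ} F_A^{B₀}`, unfolded: an object `(C, w)` of `W/A`,
1-cells `(u, αu) : (C, w) → (C₁, w₁)` and `(v, αv) : (C, w) → (C₂, w₂)` of `W/A`, and an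
arrow `ξ : F(u,αu)(f₁) → F(v,αv)(f₂)`, i.e. `ξ : u ≫ f₁ ⟶ v ≫ f₂`, of `B(C, B₀)`. -/
structure CPremor (X Y : FracObj W A B₀) where
  C : B
  w : C ⟶ A
  mem : W w
  u : C ⟶ X.C
  v : C ⟶ Y.C
  αu : w ≅ u ≫ X.w
  αv : w ≅ v ≫ Y.w
  ξ : u ≫ X.f ⟶ v ≫ Y.f

/-- A homotopy between two premorphisms, unfolded. -/
structure CHomotopy {X Y : FracObj W A B₀} (p₁ p₂ : CPremor X Y) where
  C : B
  w : C ⟶ A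
  mem : W w
  h₁ : C ⟶ p₁.C
  h₂ : C ⟶ p₂.C
  ε₁ : w ≅ h₁ ≫ p₁.w
  ε₂ : w ≅ h₂ ≫ p₂.w
  γ : h₁ ≫ p₁.u ≅ h₂ ≫ p₂.u
  δ : h₁ ≫ p₁.v ≅ h₂ ≫ p₂.v
  equ : ε₁.hom ≫ (h₁ ◁ p₁.αu.hom) ≫ (α_ h₁ p₁.u X.w).inv ≫ (γ.hom ▷ X.w) =
        ε₂.hom ≫ (h₂ ◁ p₂.αu.hom) ≫ (α_ h₂ p₂.u X.w).inv
  eqv : ε₁.hom ≫ (h₁ ◁ p₁.αv.hom) ≫ (α_ h₁ p₁.v Y.w).inv ≫ (δ.hom ▷ Y.w) =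
        ε₂.hom ≫ (h₂ ◁ p₂.αv.hom) ≫ (α_ h₂ p₂.v Y.w).inv
  eqξ : (α_ h₁ p₁.u X.f).inv ≫ (γ.hom ▷ X.f) ≫ (α_ h₂ p₂.u X.f).hom ≫ (h₂ ◁ p₂.ξ) =
        (h₁ ◁ p₁.ξ) ≫ (α_ h₁ p₁.v Y.f).inv ≫ (δ.hom ▷ Y.f) ≫ (α_ h₂ p₂.v Y.f).hom

/-- The arrows of `Colim_{(W/A)ᵒᵖ} F_A^{B₀}`: homotopy classes of premorphisms. -/
def CHom (X Y : FracObj W A B₀) : Type _ :=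
  Quot (fun p₁ p₂ : CPremor X Y => Nonempty (CHomotopy p₁ p₂))

/-- The identity premorphism. -/
def cId (X : FracObj W A B₀) : CPremor X X :=
  ⟨X.C, X.w, X.mem, 𝟙 X.C, 𝟙 X.C, (λ_ X.w).symm, (λ_ X.w).symm, 𝟙 (𝟙 X.C ≫ X.f)⟩

/-- The composite premorphism determined by a choice of composition data in `(W/A)ᵒᵖ`: an
object `(D, wD)` of `W/A`, 1-cells `(fm, φf) : (D, wD) → (C, w)` and
`(gm, φg) : (D, wD) → (C', w')` of `W/A` and an invertible 2-cell `γ : fm ≫ v ≅ gm ≫ u'`. -/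
def cCompose {X Y Z : FracObj W A B₀} (p : CPremor X Y) (q : CPremor Y Z)
    (D : B) (wD : D ⟶ A) (memD : W wD) (fm : D ⟶ p.C) (φf : wD ≅ fm ≫ p.w)
    (gm : D ⟶ q.C) (φg : wD ≅ gm ≫ q.w) (γ : fm ≫ p.v ≅ gm ≫ q.u) : CPremor X Z where
  C := D
  w := wD
  mem := memD
  u := fm ≫ p.u
  v := gm ≫ q.v
  αu := φf ≪≫ whiskerLeftIso fm p.αu ≪≫ (α_ fm p.u X.w).symm
  αv := φg ≪≫ whiskerLeftIso gm q.αv ≪≫ (α_ gm q.v Z.w).symm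
  ξ := (α_ fm p.u X.f).hom ≫ (fm ◁ p.ξ) ≫ (α_ fm p.v Y.f).inv ≫ (γ.hom ▷ Y.f) ≫
       (α_ gm q.u Y.f).hom ≫ (gm ◁ q.ξ) ≫ (α_ gm q.v Z.f).inv

/-- A quintuple `(C, u, v, α, ξ)` representing a 2-cell of Pronk's bicategory of fractions. -/
structure PQuint (X Y : FracObj W A B₀) where
  C : B
  u : C ⟶ X.C
  v : C ⟶ Y.C
  α : u ≫ X.w ≅ v ≫ Y.w
  ξ : u ≫ X.f ⟶ v ≫ Y.f
  memW : IsoToW W (u ≫ X.w)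

/-- Pronk's equivalence of quintuples. -/
structure PEquiv {X Y : FracObj W A B₀} (q₁ q₂ : PQuint X Y) where
  C : B
  h₁ : C ⟶ q₁.C
  h₂ : C ⟶ q₂.C
  γ : h₁ ≫ q₁.u ≅ h₂ ≫ q₂.u
  δ : h₁ ≫ q₁.v ≅ h₂ ≫ q₂.v
  memW : IsoToW W ((h₁ ≫ q₁.u) ≫ X.w)
  eq1 : (α_ h₁ q₁.u X.w).inv ≫ (γ.hom ▷ X.w) ≫ (α_ h₂ q₂.u X.w).hom ≫ (h₂ ◁ q₂.α.hom) =
        (h₁ ◁ q₁.α.hom) ≫ (α_ h₁ q₁.v Y.w).inv ≫ (δ.hom ▷ Y.w) ≫ (α_ h₂ q₂.v Y.w).hom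
  eq2 : (α_ h₁ q₁.u X.f).inv ≫ (γ.hom ▷ X.f) ≫ (α_ h₂ q₂.u X.f).hom ≫ (h₂ ◁ q₂.ξ) =
        (h₁ ◁ q₁.ξ) ≫ (α_ h₁ q₁.v Y.f).inv ≫ (δ.hom ▷ Y.f) ≫ (α_ h₂ q₂.v Y.f).hom

/-- The hom-sets of Pronk's hom-category `B[W⁻¹](A, B₀)`: equivalence classes of
quintuples. -/
def PHom (X Y : FracObj W A B₀) : Type _ :=
  Quot (fun q₁ q₂ : PQuint X Y => Nonempty (PEquiv q₁ q₂))

/-- The identity quintuple. -/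
def pId (X : FracObj W A B₀) : PQuint X X :=
  ⟨X.C, 𝟙 X.C, 𝟙 X.C, Iso.refl (𝟙 X.C ≫ X.w), 𝟙 (𝟙 X.C ≫ X.f),
    ⟨X.w, X.mem, ⟨λ_ X.w⟩⟩⟩

/-- Pronk's composite quintuple, for a choice of `D`, `h`, `g` and an invertible 2-cell
`γ : h ≫ v ≅ g ≫ u'` (obtained from the fractions axioms). -/
def pCompose {X Y Z : FracObj W A B₀} (q₁ : PQuint X Y) (q₂ : PQuint Y Z)
    (D : B) (h : D ⟶ q₁.C) (g : D ⟶ q₂.C) (γ : h ≫ q₁.v ≅ g ≫ q₂.u)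
    (hmem : IsoToW W ((h ≫ q₁.u) ≫ X.w)) : PQuint X Z where
  C := D
  u := h ≫ q₁.u
  v := g ≫ q₂.v
  α := (α_ h q₁.u X.w) ≪≫ whiskerLeftIso h q₁.α ≪≫ (α_ h q₁.v Y.w).symm ≪≫
       whiskerRightIso γ Y.w ≪≫ (α_ g q₂.u Y.w) ≪≫ whiskerLeftIso g q₂.α ≪≫
       (α_ g q₂.v Z.w).symm
  ξ := (α_ h q₁.u X.f).hom ≫ (h ◁ q₁.ξ) ≫ (α_ h q₁.v Y.f).inv ≫ (γ.hom ▷ Y.f) ≫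
       (α_ g q₂.u Y.f).hom ≫ (g ◁ q₂.ξ) ≫ (α_ g q₂.v Z.f).inv
  memW := hmem

/-- The canonical map from premorphisms to quintuples. -/
def toQuint {X Y : FracObj W A B₀} (p : CPremor X Y) : PQuint X Y :=
  ⟨p.C, p.u, p.v, p.αu.symm ≪≫ p.αv, p.ξ, ⟨p.w, p.mem, ⟨p.αu.symm⟩⟩⟩

/-- A realization of the pseudo-colimit `Colim_{(W/A)ᵒᵖ} F_A^{B₀}` as a category: a
composition on homotopy classes computing, for every choice of composition data, by the
pseudo-colimit composition formula, together with the category laws for the stated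
identities. -/
structure CRealization (W : ∀ ⦃a b : B⦄, (a ⟶ b) → Prop) (A B₀ : B) where
  comp : ∀ {X Y Z : FracObj W A B₀}, CHom X Y → CHom Y Z → CHom X Z
  comp_spec : ∀ {X Y Z : FracObj W A B₀} (p : CPremor X Y) (q : CPremor Y Z)
    (D : B) (wD : D ⟶ A) (memD : W wD) (fm : D ⟶ p.C) (φf : wD ≅ fm ≫ p.w)
    (gm : D ⟶ q.C) (φg : wD ≅ gm ≫ q.w) (γ : fm ≫ p.v ≅ gm ≫ q.u),
    φf.hom ≫ (fm ◁ p.αv.hom) ≫ (α_ fm p.v Y.w).inv ≫ (γ.hom ▷ Y.w) =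
      φg.hom ≫ (gm ◁ q.αu.hom) ≫ (α_ gm q.u Y.w).inv →
    comp (Quot.mk _ p) (Quot.mk _ q) =
      Quot.mk _ (cCompose p q D wD memD fm φf gm φg γ)
  id_comp : ∀ {X Y : FracObj W A B₀} (φ : CHom X Y),
    comp (Quot.mk _ (cId X)) φ = φ
  comp_id : ∀ {X Y : FracObj W A B₀} (φ : CHom X Y),
    comp φ (Quot.mk _ (cId Y)) = φ
  assoc : ∀ {X Y Z T : FracObj W A B₀} (φ : CHom X Y) (ψ : CHom Y Z) (χ : CHom Z T),
    comp (comp φ ψ) χ = comp φ (comp ψ χ)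

/-- A realization of Pronk's hom-category `B[W⁻¹](A, B₀)`: a composition on equivalence
classes of quintuples computing, for every choice of an Ore square, by Pronk's pasting
formula, together with the category laws for the stated identities. -/
structure PRealization (W : ∀ ⦃a b : B⦄, (a ⟶ b) → Prop) (A B₀ : B) where
  comp : ∀ {X Y Z : FracObj W A B₀}, PHom X Y → PHom Y Z → PHom X Z
  comp_spec : ∀ {X Y Z : FracObj W A B₀} (q₁ : PQuint X Y) (q₂ : PQuint Y Z)
    (D : B) (h : D ⟶ q₁.C) (g : D ⟶ q₂.C) (γ : h ≫ q₁.v ≅ g ≫ q₂.u)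
    (hmem : IsoToW W ((h ≫ q₁.u) ≫ X.w)),
    comp (Quot.mk _ q₁) (Quot.mk _ q₂) = Quot.mk _ (pCompose q₁ q₂ D h g γ hmem)
  id_comp : ∀ {X Y : FracObj W A B₀} (φ : PHom X Y),
    comp (Quot.mk _ (pId X)) φ = φ
  comp_id : ∀ {X Y : FracObj W A B₀} (φ : PHom X Y),
    comp φ (Quot.mk _ (pId Y)) = φ
  assoc : ∀ {X Y Z T : FracObj W A B₀} (φ : PHom X Y) (ψ : PHom Y Z) (χ : PHom Z T),
    comp (comp φ ψ) χ = comp φ (comp ψ χ)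

/-! ### The slice bicategory -/

/-- Objects of the slice `W/A`. -/
structure SL (W : ∀ ⦃a b : B⦄, (a ⟶ b) → Prop) (A : B) where
  C : B
  w : C ⟶ A
  mem : W w

/-- 1-cells of the slice. -/
structure SLHom (S T : SL W A) where
  f : S.C ⟶ T.C
  α : S.w ≅ f ≫ T.w

/-- 2-cells of the slice. -/
@[ext]
structure SL2 {S T : SL W A} (x y : SLHom S T) where
  θ : x.f ⟶ y.f
  h : x.α.hom ≫ θ ▷ T.w = y.α.hom

instance : CategoryStruct (SL W A) where
  Hom S T := SLHom S T
  id S := ⟨𝟙 S.C, (λ_ S.w).symm⟩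
  comp {_ _ T} x y := ⟨x.f ≫ y.f, x.α ≪≫ whiskerLeftIso x.f y.α ≪≫ (α_ x.f y.f T.w).symm⟩

instance slHomCat (S T : SL W A) : Category (S ⟶ T) where
  Hom x y := SL2 x y
  id x := ⟨𝟙 x.f, by simp⟩
  comp a b := ⟨a.θ ≫ b.θ, by rw [comp_whiskerRight, reassoc_of% a.h, b.h]⟩
  id_comp a := by ext; simp
  comp_id a := by ext; simp
  assoc a b c := by ext; simp

@[simp] lemma SL_id_f (S : SL W A) : SLHom.f (𝟙 S) = 𝟙 S.C := rfl
@[simp] lemma SL_id_α (S : SL W A) : SLHom.α (𝟙 S) = (λ_ S.w).symm := rfl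
@[simp] lemma SL_comp_f {S T U : SL W A} (x : S ⟶ T) (y : T ⟶ U) :
    SLHom.f (x ≫ y) = x.f ≫ y.f := rfl
@[simp] lemma SL_comp_α {S T U : SL W A} (x : S ⟶ T) (y : T ⟶ U) :
    SLHom.α (x ≫ y) = x.α ≪≫ whiskerLeftIso x.f y.α ≪≫ (α_ x.f y.f U.w).symm := rfl
@[simp] lemma SL2_id {S T : SL W A} (x : S ⟶ T) : SL2.θ (𝟙 x) = 𝟙 x.f := rfl
@[simp] lemma SL2_comp {S T : SL W A} {x y z : S ⟶ T} (a : x ⟶ y) (b : y ⟶ z) :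
    SL2.θ (a ≫ b) = a.θ ≫ b.θ := rfl

lemma SL2_ext {S T : SL W A} {x y : S ⟶ T} {a b : x ⟶ y} (h : a.θ = b.θ) : a = b :=
  SL2.ext h

/-- Build an isomorphism of 1-cells in the slice. -/
def SLiso {S T : SL W A} {x y : S ⟶ T} (i : x.f ≅ y.f)
    (h : x.α.hom ≫ i.hom ▷ T.w = y.α.hom) : x ≅ y where
  hom := ⟨i.hom, h⟩
  inv := ⟨i.inv, by rw [← h]; simp⟩
  hom_inv_id := SL2_ext (by simp)
  inv_hom_id := SL2_ext (by simp)

/-- The underlying isomorphism. -/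
def SLiso.under {S T : SL W A} {x y : S ⟶ T} (i : x ≅ y) : x.f ≅ y.f where
  hom := i.hom.θ
  inv := i.inv.θ
  hom_inv_id := congrArg SL2.θ i.hom_inv_id
  inv_hom_id := congrArg SL2.θ i.inv_hom_id

instance : Bicategory (SL W A) where
  homCategory := slHomCat
  whiskerLeft {S T U} x y z a := SL2.mk (x.f ◁ a.θ) (by
    simp only [SL_comp_α, Iso.trans_hom, whiskerLeftIso_hom, Iso.symm_hom, Category.assoc, SL_comp_f]
    rw [← associator_inv_naturality_middle, ← whiskerLeft_comp_assoc, a.h])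
  whiskerRight {S T U x y} a z := SL2.mk (a.θ ▷ z.f) (by
    simp only [SL_comp_α, Iso.trans_hom, whiskerLeftIso_hom, Iso.symm_hom, Category.assoc, SL_comp_f]
    rw [← associator_inv_naturality_left, whisker_exchange_assoc, reassoc_of% a.h])
  associator x y z := SLiso (α_ x.f y.f z.f) (by simp)
  leftUnitor x := SLiso (λ_ x.f) (by simp)
  rightUnitor x := SLiso (ρ_ x.f) (by simp)
  whiskerLeft_id _ _ := SL2_ext (by simp)
  whiskerLeft_comp _ _ _ _ _ _ := SL2_ext (by simp)
  id_whiskerLeft _ := SL2_ext (by simp [SLiso])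
  comp_whiskerLeft _ _ _ _ _ := SL2_ext (by simp [SLiso])
  id_whiskerRight _ _ := SL2_ext (by simp)
  comp_whiskerRight _ _ _ := SL2_ext (by simp)
  whiskerRight_id _ := SL2_ext (by simp [SLiso])
  whiskerRight_comp _ _ _ := SL2_ext (by simp [SLiso])
  whisker_assoc _ _ _ _ _ := SL2_ext (by simp [SLiso])
  whisker_exchange _ _ := SL2_ext (by simp [whisker_exchange])
  pentagon _ _ _ _ := SL2_ext (by simp [SLiso])
  triangle _ _ := SL2_ext (by simp [SLiso])

@[simp] lemma SL2_whiskerLeft {S T U : SL W A} (x : S ⟶ T) {y z : T ⟶ U} (a : y ⟶ z) :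
    (x ◁ a).θ = x.f ◁ a.θ := rfl
@[simp] lemma SL2_whiskerRight {S T U : SL W A} {x y : S ⟶ T} (a : x ⟶ y) (z : T ⟶ U) :
    (a ▷ z).θ = a.θ ▷ z.f := rfl
@[simp] lemma SL2_assoc_hom {S T U V : SL W A} (x : S ⟶ T) (y : T ⟶ U) (z : U ⟶ V) :
    (α_ x y z).hom.θ = (α_ x.f y.f z.f).hom := rfl
@[simp] lemma SL2_assoc_inv {S T U V : SL W A} (x : S ⟶ T) (y : T ⟶ U) (z : U ⟶ V) :
    (α_ x y z).inv.θ = (α_ x.f y.f z.f).inv := rfl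
@[simp] lemma SL2_left_hom {S T : SL W A} (x : S ⟶ T) : (λ_ x).hom.θ = (λ_ x.f).hom := rfl
@[simp] lemma SL2_left_inv {S T : SL W A} (x : S ⟶ T) : (λ_ x).inv.θ = (λ_ x.f).inv := rfl
@[simp] lemma SL2_right_hom {S T : SL W A} (x : S ⟶ T) : (ρ_ x).hom.θ = (ρ_ x.f).hom := rfl
@[simp] lemma SL2_right_inv {S T : SL W A} (x : S ⟶ T) : (ρ_ x).inv.θ = (ρ_ x.f).inv := rfl

/-! ### The slice is cofiltered -/

lemma SL_K0 (hW : RightBicalculus W) (S₁ S₂ : SL W A) :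
    ∃ T : SL W A, Nonempty (T ⟶ S₁) ∧ Nonempty (T ⟶ S₂) := by
  obtain ⟨D, u, h, hu, ⟨i⟩⟩ := hW.frc0 S₂.w S₁.w S₂.mem
  exact ⟨⟨D, u ≫ S₁.w, hW.comp _ _ hu S₁.mem⟩, ⟨⟨u, Iso.refl _⟩⟩, ⟨⟨h, i⟩⟩⟩

lemma SL_K2 (hW : RightBicalculus W) {S T : SL W A} {f g : S ⟶ T} (a b : f ⟶ g) :
    ∃ (U : SL W A) (k : U ⟶ S), k ◁ a = k ◁ b := by
  have h : a.θ ▷ T.w = b.θ ▷ T.w := by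
    rw [← cancel_epi f.α.hom, a.h, b.h]
  obtain ⟨D, u, hu, e⟩ := hW.frc2 T.w f.f g.f T.mem a.θ b.θ h
  exact ⟨⟨D, u ≫ S.w, hW.comp _ _ hu S.mem⟩, ⟨u, Iso.refl _⟩, SL2_ext e⟩

lemma SL_K1' (hW : RightBicalculus W) {S T : SL W A} (f g : S ⟶ T) :
    ∃ (U : SL W A) (k : U ⟶ S), Nonempty (k ≫ f ⟶ k ≫ g) := by
  obtain ⟨D, u, hu, β, e⟩ := hW.frc1 T.w f.f g.f T.mem (f.α.inv ≫ g.α.hom)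
  refine ⟨⟨D, u ≫ S.w, hW.comp _ _ hu S.mem⟩, ⟨u, Iso.refl _⟩, ⟨⟨β, ?_⟩⟩⟩
  simp only [SL_comp_α, Iso.trans_hom, whiskerLeftIso_hom, Iso.symm_hom, Category.assoc,
    Iso.refl_hom, Category.id_comp]
  rw [← e]
  simp

lemma SL_K1 (hW : RightBicalculus W) {S T : SL W A} (f g : S ⟶ T) :
    ∃ (U : SL W A) (k : U ⟶ S), Nonempty (k ≫ f ≅ k ≫ g) := by
  obtain ⟨U, k, ⟨a⟩⟩ := SL_K1' hW f g
  obtain ⟨V, l, ⟨b⟩⟩ := SL_K1' hW (k ≫ g) (k ≫ f)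
  obtain ⟨V₁, m, e₁⟩ := SL_K2 hW (l ◁ a ≫ b) (𝟙 _)
  obtain ⟨V₂, n, e₂⟩ := SL_K2 hW (m ◁ (b ≫ l ◁ a)) (𝟙 _)
  refine ⟨V₂, n ≫ m ≫ l ≫ k, ⟨?_⟩⟩
  have i : n ≫ m ≫ l ≫ k ≫ f ≅ n ≫ m ≫ l ≫ k ≫ g :=
    { hom := n ◁ m ◁ l ◁ a
      inv := n ◁ m ◁ b
      hom_inv_id := by
        rw [← whiskerLeft_comp, ← whiskerLeft_comp, e₁]; simp
      inv_hom_id := by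
        rw [← whiskerLeft_comp, ← whiskerLeft_comp, e₂]; simp }
  exact α_ _ _ _ ≪≫ whiskerLeftIso n (α_ _ _ _ ≪≫ whiskerLeftIso m (α_ _ _ _)) ≪≫ i ≪≫
    (α_ _ _ _ ≪≫ whiskerLeftIso n (α_ _ _ _ ≪≫ whiskerLeftIso m (α_ _ _ _))).symm

/-- The Ore condition in the slice, over an object. -/
lemma SL_Ore (hW : RightBicalculus W) {S₁ S₂ T : SL W A} (f : S₁ ⟶ T) (g : S₂ ⟶ T) :
    ∃ (U : SL W A) (k : U ⟶ S₁) (l : U ⟶ S₂), Nonempty (k ≫ f ≅ l ≫ g) := by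
  obtain ⟨V, ⟨k⟩, ⟨l⟩⟩ := SL_K0 hW S₁ S₂
  obtain ⟨U, m, ⟨i⟩⟩ := SL_K1 hW (k ≫ f) (l ≫ g)
  exact ⟨U, m ≫ k, m ≫ l, ⟨α_ _ _ _ ≪≫ i ≪≫ (α_ _ _ _).symm⟩⟩

/-! ### The pseudofunctor -/

/-- The slice object underlying an object. -/
def FracObj.S (X : FracObj W A B₀) : SL W A := ⟨X.C, X.w, X.mem⟩

/-- Object part of the pseudofunctor. -/
abbrev Fo {S : SL W A} {X : FracObj W A B₀} (a : S ⟶ X.S) : S.C ⟶ B₀ := a.f ≫ X.f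

/-- Action on 2-cells. -/
def Fm {S : SL W A} {X : FracObj W A B₀} {a b : S ⟶ X.S} (θ : a ⟶ b) : Fo a ⟶ Fo b :=
  θ.θ ▷ X.f

/-- Restriction. -/
def R {S T : SL W A} {X Y : FracObj W A B₀} (k : T ⟶ S) {a : S ⟶ X.S} {b : S ⟶ Y.S}
    (ξ : Fo a ⟶ Fo b) : Fo (k ≫ a) ⟶ Fo (k ≫ b) :=
  (α_ k.f a.f X.f).hom ≫ k.f ◁ ξ ≫ (α_ k.f b.f Y.f).inv

section
variable {S T U : SL W A} {X Y Z : FracObj W A B₀}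

@[simp] lemma Fm_id (a : S ⟶ X.S) : Fm (𝟙 a) = 𝟙 (Fo a) := id_whiskerRight _ _

lemma Fm_comp {a b c : S ⟶ X.S} (θ : a ⟶ b) (η : b ⟶ c) : Fm (θ ≫ η) = Fm θ ≫ Fm η :=
  comp_whiskerRight _ _ _

@[simp] lemma Fm_hom_inv {a b : S ⟶ X.S} (i : a ≅ b) : Fm i.hom ≫ Fm i.inv = 𝟙 _ := by
  rw [← Fm_comp, i.hom_inv_id, Fm_id]

@[simp] lemma Fm_inv_hom {a b : S ⟶ X.S} (i : a ≅ b) : Fm i.inv ≫ Fm i.hom = 𝟙 _ := by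
  rw [← Fm_comp, i.inv_hom_id, Fm_id]

@[simp] lemma Fm_hom_inv' {a b : S ⟶ X.S} (i : a ≅ b) {f : S.C ⟶ B₀} (x : Fo a ⟶ f) :
    Fm i.hom ≫ Fm i.inv ≫ x = x := by
  rw [← Category.assoc, Fm_hom_inv, Category.id_comp]

@[simp] lemma Fm_inv_hom' {a b : S ⟶ X.S} (i : a ≅ b) {f : S.C ⟶ B₀} (x : Fo b ⟶ f) :
    Fm i.inv ≫ Fm i.hom ≫ x = x := by
  rw [← Category.assoc, Fm_inv_hom, Category.id_comp]

lemma R_comp (k : T ⟶ S) {a : S ⟶ X.S} {b : S ⟶ Y.S} {c : S ⟶ Z.S}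
    (x : Fo a ⟶ Fo b) (y : Fo b ⟶ Fo c) : R k (x ≫ y) = R k x ≫ R k y := by
  simp [R]

lemma R_nat_aux {a b c d : B} (k : a ⟶ b) {f g : b ⟶ c} (t : f ⟶ g) (x : c ⟶ d) :
    (α_ k f x).hom ≫ k ◁ t ▷ x ≫ (α_ k g x).inv = (k ◁ t) ▷ x := by
  simp

lemma R_nat (k : T ⟶ S) {a b : S ⟶ X.S} (θ : a ⟶ b) : R k (Fm θ) = Fm (k ◁ θ) :=
  R_nat_aux k.f θ.θ X.f

lemma R_R_aux {p q r s t z : B} (j : p ⟶ q) (k : q ⟶ r) (a : r ⟶ s) (b : r ⟶ t) (f : s ⟶ z)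
    (g : t ⟶ z) (x : a ≫ f ⟶ b ≫ g) :
    (α_ (j ≫ k) a f).hom ≫ (j ≫ k) ◁ x ≫ (α_ (j ≫ k) b g).inv =
    (α_ j k a).hom ▷ f ≫ ((α_ j (k ≫ a) f).hom ≫
      j ◁ ((α_ k a f).hom ≫ k ◁ x ≫ (α_ k b g).inv) ≫ (α_ j (k ≫ b) g).inv) ≫
        (α_ j k b).inv ▷ g := by
  simp

lemma R_R (j : U ⟶ T) (k : T ⟶ S) {a : S ⟶ X.S} {b : S ⟶ Y.S} (x : Fo a ⟶ Fo b) :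
    R (j ≫ k) x = Fm (α_ j k a).hom ≫ R j (R k x) ≫ Fm (α_ j k b).inv :=
  R_R_aux j.f k.f a.f b.f X.f Y.f x

lemma R_two_aux {q r s t z : B} {j k : q ⟶ r} (e : j ⟶ k) (a : r ⟶ s) (b : r ⟶ t) (f : s ⟶ z)
    (g : t ⟶ z) (x : a ≫ f ⟶ b ≫ g) :
    (e ▷ a) ▷ f ≫ (α_ k a f).hom ≫ k ◁ x ≫ (α_ k b g).inv =
    ((α_ j a f).hom ≫ j ◁ x ≫ (α_ j b g).inv) ≫ (e ▷ b) ▷ g := by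
  simp only [Category.assoc]
  rw [associator_naturality_left_assoc, ← whisker_exchange_assoc, associator_inv_naturality_left]

lemma R_two {j k : T ⟶ S} (e : j ⟶ k) {a : S ⟶ X.S} {b : S ⟶ Y.S} (x : Fo a ⟶ Fo b) :
    Fm (e ▷ a) ≫ R k x = R j x ≫ Fm (e ▷ b) :=
  R_two_aux e.θ a.f b.f X.f Y.f x

lemma R_one_aux {r s t z : B} (a : r ⟶ s) (b : r ⟶ t) (f : s ⟶ z)
    (g : t ⟶ z) (x : a ≫ f ⟶ b ≫ g) :
    (α_ (𝟙 r) a f).hom ≫ 𝟙 r ◁ x ≫ (α_ (𝟙 r) b g).inv = (λ_ a).hom ▷ f ≫ x ≫ (λ_ b).inv ▷ g := by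
  simp

lemma R_one {a : S ⟶ X.S} {b : S ⟶ Y.S} (x : Fo a ⟶ Fo b) :
    R (𝟙 S) x = Fm (λ_ a).hom ≫ x ≫ Fm (λ_ b).inv :=
  R_one_aux a.f b.f X.f Y.f x

end
/-! ### Premorphisms and homotopies in terms of the slice -/

namespace CPremor
variable {X Y : FracObj W A B₀}

/-- Domain. -/
def S (p : CPremor X Y) : SL W A := ⟨p.C, p.w, p.mem⟩
/-- Left leg. -/
def a (p : CPremor X Y) : p.S ⟶ X.S := ⟨p.u, p.αu⟩
/-- Right leg. -/
def b (p : CPremor X Y) : p.S ⟶ Y.S := ⟨p.v, p.αv⟩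
/-- The 2-cell. -/
def x (p : CPremor X Y) : Fo p.a ⟶ Fo p.b := p.ξ

end CPremor

/-- Constructor. -/
def mkP {X Y : FracObj W A B₀} (S : SL W A) (a : S ⟶ X.S) (b : S ⟶ Y.S) (x : Fo a ⟶ Fo b) :
    CPremor X Y := ⟨S.C, S.w, S.mem, a.f, b.f, a.α, b.α, x⟩

/-- Homotopy, in terms of the slice. -/
def Htpy {X Y : FracObj W A B₀} (p q : CPremor X Y) : Prop :=
  ∃ (T : SL W A) (h : T ⟶ p.S) (k : T ⟶ q.S) (γ : h ≫ p.a ≅ k ≫ q.a) (δ : h ≫ p.b ≅ k ≫ q.b),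
    Fm γ.hom ≫ R k q.x = R h p.x ≫ Fm δ.hom

lemma eqxi_aux {c d e r s z : B} {h : c ⟶ d} {k : c ⟶ e} {u : d ⟶ r} {u' : e ⟶ r}
    {v : d ⟶ s} {v' : e ⟶ s} {f : r ⟶ z} {g : s ⟶ z} (γ : h ≫ u ⟶ k ≫ u') (δ : h ≫ v ⟶ k ≫ v')
    (x : u ≫ f ⟶ v ≫ g) (y : u' ≫ f ⟶ v' ≫ g) :
    ((α_ h u f).inv ≫ γ ▷ f ≫ (α_ k u' f).hom ≫ k ◁ y =
      h ◁ x ≫ (α_ h v g).inv ≫ δ ▷ g ≫ (α_ k v' g).hom) ↔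
    (γ ▷ f ≫ (α_ k u' f).hom ≫ k ◁ y ≫ (α_ k v' g).inv =
      ((α_ h u f).hom ≫ h ◁ x ≫ (α_ h v g).inv) ≫ δ ▷ g) := by
  constructor
  · intro H
    rw [Iso.inv_comp_eq] at H
    have := congrArg (· ≫ (α_ k v' g).inv) H
    simpa using this
  · intro H
    rw [Iso.inv_comp_eq]
    have := congrArg (· ≫ (α_ k v' g).hom) H
    simpa using this

lemma leg_iff {c d e r z : B} {h : c ⟶ d} {k : c ⟶ e} {u : d ⟶ r} {u' : e ⟶ r} {g : r ⟶ z}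
    {w : c ⟶ z} {w₁ : d ⟶ z} {w₂ : e ⟶ z} (ε₁ : w ≅ h ≫ w₁) (ε₂ : w ≅ k ≫ w₂)
    (a : w₁ ≅ u ≫ g) (a' : w₂ ≅ u' ≫ g) (γ : h ≫ u ⟶ k ≫ u') :
    ((ε₁ ≪≫ whiskerLeftIso h a ≪≫ (α_ h u g).symm).hom ≫ γ ▷ g =
      (ε₂ ≪≫ whiskerLeftIso k a' ≪≫ (α_ k u' g).symm).hom) ↔
    (ε₁.hom ≫ h ◁ a.hom ≫ (α_ h u g).inv ≫ γ ▷ g =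
      ε₂.hom ≫ k ◁ a'.hom ≫ (α_ k u' g).inv) := by
  simp

lemma htpy_iff {X Y : FracObj W A B₀} (p q : CPremor X Y) :
    Nonempty (CHomotopy p q) ↔ Htpy p q := by
  constructor
  · rintro ⟨H⟩
    refine ⟨⟨H.C, H.w, H.mem⟩, ⟨H.h₁, H.ε₁⟩, ⟨H.h₂, H.ε₂⟩, SLiso H.γ ?_, SLiso H.δ ?_, ?_⟩
    · exact (leg_iff H.ε₁ H.ε₂ p.αu q.αu H.γ.hom).2 H.equ
    · exact (leg_iff H.ε₁ H.ε₂ p.αv q.αv H.δ.hom).2 H.eqv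
    · exact (eqxi_aux H.γ.hom H.δ.hom p.ξ q.ξ).1 H.eqξ
  · rintro ⟨T, h, k, γ, δ, e⟩
    refine ⟨⟨T.C, T.w, T.mem, h.f, k.f, h.α, k.α, SLiso.under γ, SLiso.under δ, ?_, ?_, ?_⟩⟩
    · exact (leg_iff h.α k.α p.αu q.αu γ.hom.θ).1 γ.hom.h
    · exact (leg_iff h.α k.α p.αv q.αv δ.hom.θ).1 δ.hom.h
    · exact (eqxi_aux γ.hom.θ δ.hom.θ p.ξ q.ξ).2 e

lemma Htpy.sound {X Y : FracObj W A B₀} {p q : CPremor X Y} (h : Htpy p q) :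
    (Quot.mk _ p : CHom X Y) = Quot.mk _ q := Quot.sound ((htpy_iff p q).2 h)

/-- Homotopy of premorphisms with the same domain. -/
lemma htpy_same {X Y : FracObj W A B₀} {S : SL W A} {a a' : S ⟶ X.S} {b b' : S ⟶ Y.S}
    {x : Fo a ⟶ Fo b} {x' : Fo a' ⟶ Fo b'} (γ : a ≅ a') (δ : b ≅ b')
    (e : Fm γ.hom ≫ x' = x ≫ Fm δ.hom) : Htpy (mkP S a b x) (mkP S a' b' x') := by
  refine ⟨S, 𝟙 S, 𝟙 S, whiskerLeftIso (𝟙 S) γ, whiskerLeftIso (𝟙 S) δ, ?_⟩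
  change Fm (𝟙 S ◁ γ.hom) ≫ R (𝟙 S) x' = R (𝟙 S) x ≫ Fm (𝟙 S ◁ δ.hom)
  rw [← R_nat, ← R_comp, e, R_comp, R_nat]

lemma htpy_refl {X Y : FracObj W A B₀} (p : CPremor X Y) : Htpy p p :=
  htpy_same (S := p.S) (a := p.a) (b := p.b) (x := p.x) (x' := p.x) (Iso.refl _) (Iso.refl _)
    (by simp)

lemma R_mono {S T U : SL W A} {X Y : FracObj W A B₀} (j : U ⟶ T) (k : T ⟶ S)
    {a : S ⟶ X.S} {b : S ⟶ Y.S} {x y : Fo a ⟶ Fo b} (h : R k x = R k y) :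
    R (j ≫ k) x = R (j ≫ k) y := by
  rw [R_R, R_R, h]

lemma R_iso {S T : SL W A} {X Y : FracObj W A B₀} {j k : T ⟶ S} (i : j ≅ k)
    {a : S ⟶ X.S} {b : S ⟶ Y.S} {x y : Fo a ⟶ Fo b} (h : R j x = R j y) :
    R k x = R k y := by
  have h1 := R_two i.hom x
  have h2 := R_two i.hom y
  rw [h, ← h2] at h1
  have := congrArg (Fm (i.inv ▷ a) ≫ ·) h1
  simpa [← Category.assoc, ← Fm_comp] using this

/-- Any two legs can be compared after refinement. -/
lemma lemA_paste {X Y : FracObj W A B₀} {S₁ S₂ S T T' : SL W A} {a : S₁ ⟶ X.S} {b : S₁ ⟶ Y.S}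
    {a' : S₂ ⟶ X.S} {b' : S₂ ⟶ Y.S} {x : Fo a ⟶ Fo b} {x' : Fo a' ⟶ Fo b'}
    {h : S ⟶ S₁} {k : S ⟶ S₂} (γ : h ≫ a ⟶ k ≫ a') (δ : h ≫ b ⟶ k ≫ b')
    (e : Fm γ ≫ R k x' = R h x ≫ Fm δ) {h' : T ⟶ S₁} {k' : T ⟶ S₂} (j : T' ⟶ T) (l : T' ⟶ S)
    (i : j ≫ h' ≅ l ≫ h) (i' : j ≫ k' ≅ l ≫ k) :
    Fm ((α_ j h' a).inv ≫ i.hom ▷ a ≫ (α_ l h a).hom ≫ l ◁ γ ≫ (α_ l k a').inv ≫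
      i'.inv ▷ a' ≫ (α_ j k' a').hom) ≫ R j (R k' x') =
    R j (R h' x) ≫ Fm ((α_ j h' b).inv ≫ i.hom ▷ b ≫ (α_ l h b).hom ≫ l ◁ δ ≫ (α_ l k b').inv ≫
      i'.inv ▷ b' ≫ (α_ j k' b').hom) := by
  have e1 : R j (R k' x') = Fm (α_ j k' a').inv ≫ R (j ≫ k') x' ≫ Fm (α_ j k' b').hom := by
    simp [R_R]
  have e2 : R j (R h' x) = Fm (α_ j h' a).inv ≫ R (j ≫ h') x ≫ Fm (α_ j h' b).hom := by
    simp [R_R]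
  have e3 := congrArg (R l) e
  rw [R_comp, R_comp, R_nat, R_nat] at e3
  have e4 : R l (R k x') = Fm (α_ l k a').inv ≫ R (l ≫ k) x' ≫ Fm (α_ l k b').hom := by
    simp [R_R]
  have e5 : R l (R h x) = Fm (α_ l h a).inv ≫ R (l ≫ h) x ≫ Fm (α_ l h b).hom := by
    simp [R_R]
  have e6 := R_two i.hom x
  have e7 := R_two i'.inv x'
  rw [e4, e5] at e3
  have e8 : Fm (α_ l h a).hom ≫ Fm (l ◁ γ) ≫ Fm (α_ l k a').inv ≫ R (l ≫ k) x' =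
      R (l ≫ h) x ≫ Fm (α_ l h b).hom ≫ Fm (l ◁ δ) ≫ Fm (α_ l k b').inv := by
    have := congrArg (fun t => Fm (α_ l h a).hom ≫ t ≫ Fm (α_ l k b').inv) e3
    simpa using this
  simp only [Fm_comp, Category.assoc, e1, e2, Fm_hom_inv']
  rw [reassoc_of% e7, reassoc_of% e8, ← reassoc_of% e6]

lemma lemA (hW : RightBicalculus W) {X Y : FracObj W A B₀} {p q : CPremor X Y} (H : Htpy p q)
    {T : SL W A} (h : T ⟶ p.S) (k : T ⟶ q.S) (γ : h ≫ p.a ⟶ k ≫ q.a) (δ : h ≫ p.b ⟶ k ≫ q.b) :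
    ∃ (T' : SL W A) (j : T' ⟶ T), R j (Fm γ ≫ R k q.x) = R j (R h p.x ≫ Fm δ) := by
  obtain ⟨S, h₀, k₀, γ₀, δ₀, e⟩ := H
  obtain ⟨T₁, j₁, l₁, ⟨i₁⟩⟩ := SL_Ore hW h h₀
  obtain ⟨T₂, m, ⟨i₂⟩⟩ := SL_K1 hW (j₁ ≫ k) (l₁ ≫ k₀)
  obtain ⟨θ, η, P⟩ : ∃ (θ : (m ≫ j₁) ≫ h ≫ p.a ⟶ (m ≫ j₁) ≫ k ≫ q.a)
      (η : (m ≫ j₁) ≫ h ≫ p.b ⟶ (m ≫ j₁) ≫ k ≫ q.b),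
      Fm θ ≫ R (m ≫ j₁) (R k q.x) = R (m ≫ j₁) (R h p.x) ≫ Fm η :=
    ⟨_, _, lemA_paste γ₀.hom δ₀.hom e (m ≫ j₁) (m ≫ l₁) (h' := h) (k' := k)
      (α_ _ _ _ ≪≫ whiskerLeftIso m i₁ ≪≫ (α_ _ _ _).symm)
      (α_ _ _ _ ≪≫ i₂ ≪≫ (α_ _ _ _).symm)⟩
  obtain ⟨T₃, n, en⟩ := SL_K2 hW θ ((m ≫ j₁) ◁ γ)
  obtain ⟨T₄, o, eo⟩ := SL_K2 hW (n ◁ η) (n ◁ (m ≫ j₁) ◁ δ)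
  refine ⟨T₄, o ≫ n ≫ m ≫ j₁, ?_⟩
  have P2 := congrArg (fun t => R o (R n t)) P
  simp only [R_comp, R_nat] at P2
  rw [en, eo] at P2
  have key : R o (R n (R (m ≫ j₁) (Fm γ ≫ R k q.x))) =
      R o (R n (R (m ≫ j₁) (R h p.x ≫ Fm δ))) := by
    simp only [R_comp, R_nat]
    exact P2
  rw [R_R o, R_R n, R_R o, R_R n]
  simp only [R_comp] at key ⊢
  simp only [Category.assoc] at key ⊢
  rw [reassoc_of% key]
/-! ### Composition -/

section
variable {X Y Z V : FracObj W A B₀}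

/-- Composite premorphism. -/
def cmp (p : CPremor X Y) (q : CPremor Y Z) {D : SL W A} (f : D ⟶ p.S) (g : D ⟶ q.S)
    (γ : f ≫ p.b ≅ g ≫ q.a) : CPremor X Z :=
  mkP D (f ≫ p.a) (g ≫ q.b) (R f p.x ≫ Fm γ.hom ≫ R g q.x)

lemma cmp_wd (hW : RightBicalculus W) {p p' : CPremor X Y} {q q' : CPremor Y Z}
    (hp : Htpy p p') (hq : Htpy q q')
    {D : SL W A} (f : D ⟶ p.S) (g : D ⟶ q.S) (γ : f ≫ p.b ≅ g ≫ q.a)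
    {D' : SL W A} (f' : D' ⟶ p'.S) (g' : D' ⟶ q'.S) (γ' : f' ≫ p'.b ≅ g' ≫ q'.a) :
    Htpy (cmp p q f g γ) (cmp p' q' f' g' γ') := by
  obtain ⟨T₁, t₁, t₁', ⟨iX⟩⟩ := SL_Ore hW (f ≫ p.a) (f' ≫ p'.a)
  obtain ⟨T₂, m₂, ⟨iY⟩⟩ := SL_K1 hW (t₁ ≫ f ≫ p.b) (t₁' ≫ f' ≫ p'.b)
  obtain ⟨T₃, m₃, ⟨iZ⟩⟩ := SL_K1 hW (m₂ ≫ t₁ ≫ g ≫ q.b) (m₂ ≫ t₁' ≫ g' ≫ q'.b)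
  obtain ⟨T, t, t', ⟨γX⟩, ⟨γY⟩, ⟨γZ⟩⟩ : ∃ (T : SL W A) (t : T ⟶ D) (t' : T ⟶ D'),
      Nonempty (t ≫ f ≫ p.a ≅ t' ≫ f' ≫ p'.a) ∧ Nonempty (t ≫ f ≫ p.b ≅ t' ≫ f' ≫ p'.b) ∧
      Nonempty (t ≫ g ≫ q.b ≅ t' ≫ g' ≫ q'.b) :=
    ⟨T₃, m₃ ≫ m₂ ≫ t₁, m₃ ≫ m₂ ≫ t₁',
      ⟨α_ _ _ _ ≪≫ whiskerLeftIso m₃ (α_ _ _ _ ≪≫ whiskerLeftIso m₂ iX ≪≫ (α_ _ _ _).symm) ≪≫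
        (α_ _ _ _).symm⟩,
      ⟨α_ _ _ _ ≪≫ whiskerLeftIso m₃ (α_ _ _ _ ≪≫ iY ≪≫ (α_ _ _ _).symm) ≪≫
        (α_ _ _ _).symm⟩,
      ⟨α_ _ _ _ ≪≫ whiskerLeftIso m₃ (α_ _ _ _) ≪≫ iZ ≪≫ whiskerLeftIso m₃ (α_ _ _ _).symm ≪≫
        (α_ _ _ _).symm⟩⟩
  obtain ⟨U₁, j₁, e₁⟩ := lemA hW hp (t ≫ f) (t' ≫ f')
    ((α_ _ _ _).hom ≫ γX.hom ≫ (α_ _ _ _).inv) ((α_ _ _ _).hom ≫ γY.hom ≫ (α_ _ _ _).inv)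
  obtain ⟨U₂, j₂, e₂⟩ := lemA hW hq (t ≫ g) (t' ≫ g')
    ((α_ _ _ _).hom ≫ (t ◁ γ.inv ≫ γY.hom ≫ t' ◁ γ'.hom) ≫ (α_ _ _ _).inv)
    ((α_ _ _ _).hom ≫ γZ.hom ≫ (α_ _ _ _).inv)
  obtain ⟨U, l₁, l₂, ⟨i⟩⟩ := SL_Ore hW j₁ j₂
  replace e₁ := R_mono l₁ j₁ e₁
  replace e₂ := R_iso i.symm (R_mono l₂ j₂ e₂)
  generalize l₁ ≫ j₁ = j at e₁ e₂
  have e₁' : R j (Fm γX.hom ≫ R t' (R f' p'.x)) = R j (R t (R f p.x) ≫ Fm γY.hom) := by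
    have := congrArg (fun z => R j (Fm (α_ t f p.a).inv) ≫ z ≫ R j (Fm (α_ t' f' p'.b).hom)) e₁
    simp only [← R_comp] at this
    simpa [R_R, Fm_comp] using this
  have e₂' : R j (Fm (t ◁ γ.inv ≫ γY.hom ≫ t' ◁ γ'.hom) ≫ R t' (R g' q'.x)) =
      R j (R t (R g q.x) ≫ Fm γZ.hom) := by
    have := congrArg (fun z => R j (Fm (α_ t g q.a).inv) ≫ z ≫ R j (Fm (α_ t' g' q'.b).hom)) e₂
    simp only [← R_comp] at this
    simpa [R_R, Fm_comp] using this
  clear e₁ e₂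
  refine ⟨U, j ≫ t, j ≫ t', α_ _ _ _ ≪≫ whiskerLeftIso j γX ≪≫ (α_ _ _ _).symm,
    α_ _ _ _ ≪≫ whiskerLeftIso j γZ ≪≫ (α_ _ _ _).symm, ?_⟩
  have key : R j (Fm γX.hom ≫ R t' (R f' p'.x ≫ Fm γ'.hom ≫ R g' q'.x)) =
      R j (R t (R f p.x ≫ Fm γ.hom ≫ R g q.x) ≫ Fm γZ.hom) := by
    have hY : R j (Fm γY.hom ≫ Fm (t' ◁ γ'.hom)) = R j (Fm (t ◁ γ.hom)) ≫
        R j (Fm (t ◁ γ.inv ≫ γY.hom ≫ t' ◁ γ'.hom)) := by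
      rw [← R_comp, ← Fm_comp, ← Fm_comp, ← whiskerLeft_comp_assoc]; simp
    simp only [R_comp, R_nat] at e₁' e₂' hY ⊢
    simp only [Category.assoc]
    rw [reassoc_of% e₁', reassoc_of% hY, e₂']
  change Fm ((α_ j t (f ≫ p.a)).hom ≫ j ◁ γX.hom ≫ (α_ j t' (f' ≫ p'.a)).inv) ≫
      R (j ≫ t') (R f' p'.x ≫ Fm γ'.hom ≫ R g' q'.x) =
    R (j ≫ t) (R f p.x ≫ Fm γ.hom ≫ R g q.x) ≫
      Fm ((α_ j t (g ≫ q.b)).hom ≫ j ◁ γZ.hom ≫ (α_ j t' (g' ≫ q'.b)).inv)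
  rw [R_R, R_R, Fm_comp, Fm_comp, Fm_comp, Fm_comp, ← R_nat, ← R_nat]
  rw [R_comp j (Fm γX.hom), R_comp j _ (Fm γZ.hom)] at key
  simp only [Category.assoc, Fm_inv_hom']
  rw [reassoc_of% key]

lemma cmp_exists (hW : RightBicalculus W) (p : CPremor X Y) (q : CPremor Y Z) :
    ∃ (D : SL W A) (f : D ⟶ p.S) (g : D ⟶ q.S), Nonempty (f ≫ p.b ≅ g ≫ q.a) :=
  SL_Ore hW p.b q.a

/-- A chosen composite. -/
noncomputable def chosen (hW : RightBicalculus W) (p : CPremor X Y) (q : CPremor Y Z) :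
    CPremor X Z :=
  cmp p q (cmp_exists hW p q).choose_spec.choose (cmp_exists hW p q).choose_spec.choose_spec.choose
    (cmp_exists hW p q).choose_spec.choose_spec.choose_spec.some

/-- Composition on classes. -/
noncomputable def cComp (hW : RightBicalculus W) (φ : CHom X Y) (ψ : CHom Y Z) : CHom X Z :=
  Quot.lift (fun p => Quot.lift (fun q => (Quot.mk _ (chosen hW p q) : CHom X Z))
      (fun q q' h => (cmp_wd hW (htpy_refl p) ((htpy_iff q q').1 h) _ _ _ _ _ _).sound))
    (fun p p' h => by
      ext ψ
      induction ψ using Quot.ind with | _ q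
      exact (cmp_wd hW ((htpy_iff p p').1 h) (htpy_refl q) _ _ _ _ _ _).sound) φ ψ

lemma cComp_spec (hW : RightBicalculus W) (p : CPremor X Y) (q : CPremor Y Z)
    {D : SL W A} (f : D ⟶ p.S) (g : D ⟶ q.S) (γ : f ≫ p.b ≅ g ≫ q.a) :
    cComp hW (Quot.mk _ p) (Quot.mk _ q) = Quot.mk _ (cmp p q f g γ) :=
  (cmp_wd hW (htpy_refl p) (htpy_refl q) _ _ _ _ _ _).sound

lemma R_id {S T : SL W A} (k : T ⟶ S) (a : S ⟶ X.S) : R k (𝟙 (Fo a)) = 𝟙 (Fo (k ≫ a)) := by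
  rw [← Fm_id, R_nat, whiskerLeft_id, Fm_id]

lemma cComp_id_left (hW : RightBicalculus W) (φ : CHom X Y) :
    cComp hW (Quot.mk _ (cId X)) φ = φ := by
  induction φ using Quot.ind with | _ p
  rw [cComp_spec hW (cId X) p (D := p.S) p.a (𝟙 _) (ρ_ p.a ≪≫ (λ_ p.a).symm)]
  refine (htpy_same (S := p.S) (a' := p.a) (b' := p.b) (x' := p.x)
    (ρ_ p.a) (λ_ p.b) ?_).sound
  change Fm (ρ_ p.a).hom ≫ p.x = (R p.a (𝟙 (Fo (𝟙 X.S))) ≫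
    Fm (ρ_ p.a ≪≫ (λ_ p.a).symm).hom ≫ R (𝟙 p.S) p.x) ≫ Fm (λ_ p.b).hom
  rw [R_id, R_one]
  simp [Fm_comp]

lemma cComp_id_right (hW : RightBicalculus W) (φ : CHom X Y) :
    cComp hW φ (Quot.mk _ (cId Y)) = φ := by
  induction φ using Quot.ind with | _ p
  rw [cComp_spec hW p (cId Y) (D := p.S) (𝟙 _) p.b (λ_ p.b ≪≫ (ρ_ p.b).symm)]
  refine (htpy_same (S := p.S) (a' := p.a) (b' := p.b) (x' := p.x)
    (λ_ p.a) (ρ_ p.b) ?_).sound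
  change Fm (λ_ p.a).hom ≫ p.x = (R (𝟙 p.S) p.x ≫ Fm (λ_ p.b ≪≫ (ρ_ p.b).symm).hom ≫
    R p.b (𝟙 (Fo (𝟙 Y.S)))) ≫ Fm (ρ_ p.b).hom
  rw [R_id, R_one]
  simp [Fm_comp]

lemma cComp_assoc (hW : RightBicalculus W) (φ : CHom X Y) (ψ : CHom Y Z) (χ : CHom Z V) :
    cComp hW (cComp hW φ ψ) χ = cComp hW φ (cComp hW ψ χ) := by
  induction φ using Quot.ind with | _ p
  induction ψ using Quot.ind with | _ q
  induction χ using Quot.ind with | _ r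
  obtain ⟨D, f, g, ⟨γ⟩⟩ := cmp_exists hW p q
  obtain ⟨D', f', g', ⟨γ'⟩⟩ := cmp_exists hW q r
  obtain ⟨T, t, t', ⟨i⟩⟩ := SL_Ore hW g f'
  rw [cComp_spec hW p q f g γ, cComp_spec hW q r f' g' γ']
  let c₁ : t ≫ (g ≫ q.b) ≅ (t' ≫ g') ≫ r.a :=
    (α_ t g q.b).symm ≪≫ whiskerRightIso i q.b ≪≫ α_ t' f' q.b ≪≫ whiskerLeftIso t' γ' ≪≫
      (α_ t' g' r.a).symm
  let c₂ : (t ≫ f) ≫ p.b ≅ t' ≫ (f' ≫ q.a) :=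
    α_ t f p.b ≪≫ whiskerLeftIso t γ ≪≫ (α_ t g q.a).symm ≪≫ whiskerRightIso i q.a ≪≫
      α_ t' f' q.a
  rw [cComp_spec hW (cmp p q f g γ) r (D := T) t (t' ≫ g') c₁,
    cComp_spec hW p (cmp q r f' g' γ') (D := T) (t ≫ f) t' c₂]
  refine (htpy_same (S := T) (α_ t f p.a).symm (α_ t' g' r.b) ?_).sound
  change Fm (α_ t f p.a).inv ≫ R (t ≫ f) p.x ≫ Fm c₂.hom ≫
      R t' (R f' q.x ≫ Fm γ'.hom ≫ R g' r.x) =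
    (R t (R f p.x ≫ Fm γ.hom ≫ R g q.x) ≫ Fm c₁.hom ≫ R (t' ≫ g') r.x) ≫ Fm (α_ t' g' r.b).hom
  have h := R_two i.hom q.x
  rw [R_R, R_R] at h
  have h' : Fm (α_ t g q.a).inv ≫ Fm (i.hom ▷ q.a) ≫ Fm (α_ t' f' q.a).hom ≫ R t' (R f' q.x) =
      R t (R g q.x) ≫ Fm (α_ t g q.b).inv ≫ Fm (i.hom ▷ q.b) ≫ Fm (α_ t' f' q.b).hom := by
    have := congrArg (fun z => Fm (α_ t g q.a).inv ≫ z ≫ Fm (α_ t' f' q.b).hom) h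
    simpa using this
  simp only [c₁, c₂, Iso.trans_hom, Iso.symm_hom, whiskerLeftIso_hom, whiskerRightIso_hom, Fm_comp,
    R_comp, R_nat, R_R t f, R_R t' g', Category.assoc, Fm_inv_hom', Fm_inv_hom, Category.comp_id]
  rw [reassoc_of% h']

end
/-! ### Comparison with Pronk's quintuples -/

section
variable {X Y Z V : FracObj W A B₀}

lemma eq1_iff {c d e r s z : B} {h : c ⟶ d} {k : c ⟶ e} {u : d ⟶ r} {u' : e ⟶ r} {f : r ⟶ z}
    {v : d ⟶ s} {v' : e ⟶ s} {g : s ⟶ z}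
    {w : c ⟶ z} {w₁ : d ⟶ z} {w₂ : e ⟶ z} (ε₁ : w ≅ h ≫ w₁) (ε₂ : w ≅ k ≫ w₂)
    (a : w₁ ≅ u ≫ f) (a' : w₂ ≅ u' ≫ f) (γ : h ≫ u ⟶ k ≫ u')
    (b : w₁ ≅ v ≫ g) (b' : w₂ ≅ v' ≫ g) (δ : h ≫ v ⟶ k ≫ v')
    (equ : ε₁.hom ≫ h ◁ a.hom ≫ (α_ h u f).inv ≫ γ ▷ f =
      ε₂.hom ≫ k ◁ a'.hom ≫ (α_ k u' f).inv) :
    (ε₁.hom ≫ h ◁ b.hom ≫ (α_ h v g).inv ≫ δ ▷ g =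
      ε₂.hom ≫ k ◁ b'.hom ≫ (α_ k v' g).inv) ↔
    ((α_ h u f).inv ≫ γ ▷ f ≫ (α_ k u' f).hom ≫ k ◁ (a'.inv ≫ b'.hom) =
      h ◁ (a.inv ≫ b.hom) ≫ (α_ h v g).inv ≫ δ ▷ g ≫ (α_ k v' g).hom) := by
  rw [← cancel_epi (ε₁ ≪≫ whiskerLeftIso h a).hom, ← cancel_mono (α_ k v' g).hom]
  simp only [Iso.trans_hom, whiskerLeftIso_hom, Category.assoc]
  rw [reassoc_of% equ, ← whiskerLeft_comp_assoc h a.hom, ← Category.assoc a.hom]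
  simp only [Iso.hom_inv_id, Category.id_comp, Iso.inv_hom_id_assoc, Iso.inv_hom_id,
    Category.comp_id, ← whiskerLeft_comp, Iso.hom_inv_id_assoc]
  exact eq_comm

/-- Quintuple to premorphism. -/
def fromQuint (hW : RightBicalculus W) (q : PQuint X Y) : CPremor X Y where
  C := q.C
  w := q.u ≫ X.w
  mem := by obtain ⟨w', h, i⟩ := q.memW; exact hW.iso_closed _ _ h i
  u := q.u
  v := q.v
  αu := Iso.refl _
  αv := q.α
  ξ := q.ξ

lemma PQuint_ext {C : B} {u : C ⟶ X.C} {v : C ⟶ Y.C} {α α' : u ≫ X.w ≅ v ≫ Y.w}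
    {ξ ξ' : u ≫ X.f ⟶ v ≫ Y.f} {m m' : IsoToW W (u ≫ X.w)} (h : α.hom = α'.hom) (h' : ξ = ξ') :
    (⟨C, u, v, α, ξ, m⟩ : PQuint X Y) = ⟨C, u, v, α', ξ', m'⟩ := by
  obtain rfl : α = α' := Iso.ext h
  subst h'
  rfl

lemma toQuint_fromQuint (hW : RightBicalculus W) (q : PQuint X Y) :
    toQuint (fromQuint hW q) = q :=
  PQuint_ext (Category.id_comp q.α.hom) rfl

/-- Homotopies give equivalences of quintuples. -/
def toQuint_htpy {p q : CPremor X Y} (H : CHomotopy p q) : PEquiv (toQuint p) (toQuint q) where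
  C := H.C
  h₁ := H.h₁
  h₂ := H.h₂
  γ := H.γ
  δ := H.δ
  memW := ⟨H.w, H.mem, ⟨(H.ε₁ ≪≫ whiskerLeftIso H.h₁ p.αu ≪≫ (α_ H.h₁ p.u X.w).symm).symm⟩⟩
  eq1 := (eq1_iff H.ε₁ H.ε₂ p.αu q.αu H.γ.hom p.αv q.αv H.δ.hom H.equ).1 H.eqv
  eq2 := H.eqξ

lemma fromQuint_equiv (hW : RightBicalculus W) {q r : PQuint X Y} (H : PEquiv q r) :
    Nonempty (CHomotopy (fromQuint hW q) (fromQuint hW r)) := by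
  let ε₂ : H.h₁ ≫ q.u ≫ X.w ≅ H.h₂ ≫ r.u ≫ X.w :=
    (α_ H.h₁ q.u X.w).symm ≪≫ whiskerRightIso H.γ X.w ≪≫ α_ H.h₂ r.u X.w
  have equ : (Iso.refl (H.h₁ ≫ q.u ≫ X.w)).hom ≫ H.h₁ ◁ (Iso.refl (q.u ≫ X.w)).hom ≫
      (α_ H.h₁ q.u X.w).inv ≫ H.γ.hom ▷ X.w =
      ε₂.hom ≫ H.h₂ ◁ (Iso.refl (r.u ≫ X.w)).hom ≫ (α_ H.h₂ r.u X.w).inv := by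
    simp [ε₂]
  refine ⟨⟨H.C, H.h₁ ≫ q.u ≫ X.w, ?_, H.h₁, H.h₂, Iso.refl _, ε₂, H.γ, H.δ, equ, ?_, H.eq2⟩⟩
  · obtain ⟨w', h, ⟨i⟩⟩ := H.memW
    exact hW.iso_closed _ _ h ⟨(α_ H.h₁ q.u X.w).symm ≪≫ i⟩
  · refine (eq1_iff (Iso.refl _) ε₂ (Iso.refl _) (Iso.refl _) H.γ.hom q.α r.α H.δ.hom equ).2 ?_
    simpa using H.eq1

lemma fromQuint_toQuint (hW : RightBicalculus W) (p : CPremor X Y) :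
    Nonempty (CHomotopy (fromQuint hW (toQuint p)) p) := by
  refine ⟨⟨p.C, p.w, p.mem, 𝟙 p.C, 𝟙 p.C, p.αu ≪≫ (λ_ _).symm, (λ_ _).symm,
    Iso.refl _, Iso.refl _, ?_, ?_, ?_⟩⟩
  · simp [fromQuint, toQuint]
  · simp [fromQuint, toQuint]
  · simp [fromQuint, toQuint]

/-- The comparison bijection. -/
def cpEquiv (hW : RightBicalculus W) : CHom X Y ≃ PHom X Y where
  toFun := Quot.map toQuint (fun _ _ ⟨H⟩ => ⟨toQuint_htpy H⟩)
  invFun := Quot.map (fromQuint hW) (fun _ _ ⟨H⟩ => fromQuint_equiv hW H)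
  left_inv φ := by
    induction φ using Quot.ind with | _ p
    exact Quot.sound (fromQuint_toQuint hW p)
  right_inv φ := by
    induction φ using Quot.ind with | _ p
    exact congrArg (Quot.mk _) (toQuint_fromQuint hW p)

lemma cpEquiv_id (hW : RightBicalculus W) (X : FracObj W A B₀) :
    cpEquiv hW (Quot.mk _ (cId X)) = Quot.mk _ (pId X) :=
  congrArg (Quot.mk _) (PQuint_ext (λ_ X.w).hom_inv_id rfl)

lemma cpEquiv_symm_id (hW : RightBicalculus W) (X : FracObj W A B₀) :
    (cpEquiv hW).symm (Quot.mk _ (pId X)) = (Quot.mk _ (cId X) : CHom X X) :=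
  (Equiv.symm_apply_eq _).2 (cpEquiv_id hW X).symm

/-- The compatibility condition makes `γ` a 2-cell of the slice. -/
lemma cCompose_eq (p : CPremor X Y) (q : CPremor Y Z)
    (D : B) (wD : D ⟶ A) (memD : W wD) (fm : D ⟶ p.C) (φf : wD ≅ fm ≫ p.w)
    (gm : D ⟶ q.C) (φg : wD ≅ gm ≫ q.w) (γ : fm ≫ p.v ≅ gm ≫ q.u)
    (h : φf.hom ≫ (fm ◁ p.αv.hom) ≫ (α_ fm p.v Y.w).inv ≫ (γ.hom ▷ Y.w) =
      φg.hom ≫ (gm ◁ q.αu.hom) ≫ (α_ gm q.u Y.w).inv) :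
    ∃ γ' : (SLHom.mk fm φf : (⟨D, wD, memD⟩ : SL W A) ⟶ p.S) ≫ p.b ≅
        (SLHom.mk gm φg : (⟨D, wD, memD⟩ : SL W A) ⟶ q.S) ≫ q.a,
      cmp p q _ _ γ' = cCompose p q D wD memD fm φf gm φg γ := by
  refine ⟨SLiso γ ((leg_iff φf φg p.αv q.αu γ.hom).2 h), ?_⟩
  have : ((α_ fm p.u X.f).hom ≫ fm ◁ p.ξ ≫ (α_ fm p.v Y.f).inv) ≫ γ.hom ▷ Y.f ≫
      ((α_ gm q.u Y.f).hom ≫ gm ◁ q.ξ ≫ (α_ gm q.v Z.f).inv) =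
      (cCompose p q D wD memD fm φf gm φg γ).ξ := by
    simp [cCompose]
  exact congrArg (fun ξ => ({cCompose p q D wD memD fm φf gm φg γ with ξ := ξ} : CPremor X Z)) this

/-- The realization of the pseudo-colimit. -/
noncomputable def theRc (hW : RightBicalculus W) (A B₀ : B) : CRealization W A B₀ where
  comp := cComp hW
  comp_spec p q D wD memD fm φf gm φg γ h := by
    obtain ⟨γ', e⟩ := cCompose_eq p q D wD memD fm φf gm φg γ h
    rw [← e]
    exact cComp_spec hW p q _ _ γ'
  id_comp := cComp_id_left hW
  comp_id := cComp_id_right hW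
  assoc := cComp_assoc hW

lemma pComp_spec (hW : RightBicalculus W) (q₁ : PQuint X Y) (q₂ : PQuint Y Z)
    (D : B) (h : D ⟶ q₁.C) (g : D ⟶ q₂.C) (γ : h ≫ q₁.v ≅ g ≫ q₂.u)
    (hmem : IsoToW W ((h ≫ q₁.u) ≫ X.w)) :
    cpEquiv hW (cComp hW (Quot.mk _ (fromQuint hW q₁)) (Quot.mk _ (fromQuint hW q₂))) =
      Quot.mk _ (pCompose q₁ q₂ D h g γ hmem) := by
  let φg : (h ≫ q₁.u) ≫ X.w ≅ g ≫ q₂.u ≫ Y.w :=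
    α_ h q₁.u X.w ≪≫ whiskerLeftIso h q₁.α ≪≫ (α_ h q₁.v Y.w).symm ≪≫
      whiskerRightIso γ Y.w ≪≫ α_ g q₂.u Y.w
  have hD : W ((h ≫ q₁.u) ≫ X.w) := by
    obtain ⟨w', hw, i⟩ := hmem
    exact hW.iso_closed _ _ hw i
  have := (theRc hW A B₀).comp_spec (fromQuint hW q₁) (fromQuint hW q₂) D _ hD h
    (α_ h q₁.u X.w) g φg γ (by simp [fromQuint, φg])
  refine (congrArg (cpEquiv hW) this).trans (congrArg (Quot.mk _) (PQuint_ext ?_ rfl))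
  change ((α_ h q₁.u X.w ≪≫ whiskerLeftIso h (Iso.refl (q₁.u ≫ X.w)) ≪≫
    (α_ h q₁.u X.w).symm).symm ≪≫ φg ≪≫ whiskerLeftIso g q₂.α ≪≫ (α_ g q₂.v Z.w).symm).hom = _
  rw [Iso.trans_hom]
  simp [φg]

/-- The realization of Pronk's hom-category. -/
noncomputable def theRp (hW : RightBicalculus W) (A B₀ : B) : PRealization W A B₀ where
  comp φ ψ := cpEquiv hW (cComp hW ((cpEquiv hW).symm φ) ((cpEquiv hW).symm ψ))
  comp_spec := pComp_spec hW
  id_comp φ := (congrArg (fun t => cpEquiv hW (cComp hW t _)) (cpEquiv_symm_id hW _)).trans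
    (by rw [cComp_id_left, Equiv.apply_symm_apply])
  comp_id φ := (congrArg (fun t => cpEquiv hW (cComp hW _ t)) (cpEquiv_symm_id hW _)).trans
    (by rw [cComp_id_right, Equiv.apply_symm_apply])
  assoc φ ψ χ := by
    rw [Equiv.symm_apply_apply, Equiv.symm_apply_apply, cComp_assoc]

end

/-- If `W` admits a right bicalculus of fractions, then the pseudo-colimit
`Colim_{(W/A)ᵒᵖ} F_A^{B₀}` and Pronk's hom-category `B[W⁻¹](A, B₀)` are well-defined
categories (with the stated identities and choice-independent compositions), and they are
isomorphic via the identity on objects and the canonical correspondence of arrows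
`[(C, w), (u, αu), (v, αv), ξ] ↦ [(C, u, v, αv ∘ αu⁻¹, ξ)]`. -/
theorem colim_iso_fractions_homcat (hW : RightBicalculus W) (A B₀ : B) :
    ∃ (Rc : CRealization W A B₀) (Rp : PRealization W A B₀)
      (e : ∀ {X Y : FracObj W A B₀}, CHom X Y ≃ PHom X Y),
      (∀ (X Y : FracObj W A B₀) (p : CPremor X Y),
        e (Quot.mk _ p) = Quot.mk _ (toQuint p)) ∧
      (∀ X : FracObj W A B₀,
        e (Quot.mk _ (cId X)) = Quot.mk _ (pId X)) ∧
      (∀ (X Y Z : FracObj W A B₀) (φ : CHom X Y) (ψ : CHom Y Z),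
        e (Rc.comp φ ψ) = Rp.comp (e φ) (e ψ)) := by
  exact ⟨theRc hW A B₀, theRp hW A B₀, cpEquiv hW, fun _ _ _ => rfl, cpEquiv_id hW,
    fun _ _ _ φ ψ => by simp [theRc, theRp]⟩

end Paper
end
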